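/- Let N ≥ 2, L ≥ 0, and let p_1,…,p_N : closure(K_a) → ℝ be Lipschitz continuous with Lipschitz constant at most L, with p_i(x) > 2N/(N+2) on closure(K_a) and μ := sup_{K_a} p^∨(x)/p^∧(x) < 1 + 1/N. Fix i ∈ {1,…,N}, a real r with 2/(N+2) < r < 2 − μ·2N/(N+2), δ ∈ (0,1) and M₀ > 0. Then there exists a constant C, depending on δ, r, L, a, N, the bounds of the p_i and M₀, but not on ε or u, such that for every ε ∈ (0,1) and every smooth function u on closure(K_a) vanishing on ∂K_a with ‖u‖_{2,K_a} ≤ M₀: ∫_{K_a} (ε² + |D_i u|²)^{(p_i(x)+r−2)/2} |D_i u|² dx ≤ δ Σ_{j=1}^N ∫_{K_a} (ε² + |D_i u|²)^{(p_i(x)−2)/2} (D²_{ij} u)² dx + C. -/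

import Mathlib

noncomputable section
open MeasureTheory Real

/-- The open parallelepiped `K_a = {x : |x_i| < a_i}`. -/
def Ka {N : ℕ} (a : Fin N → ℝ) : Set (Fin N → ℝ) := {x | ∀ i, |x i| < a i}

/-- The `i`-th partial derivative `D_i`. -/
def Dop {N : ℕ} (i : Fin N) (f : (Fin N → ℝ) → ℝ) : (Fin N → ℝ) → ℝ :=
  fun x => fderiv ℝ f x (Pi.single i 1)

/-- The `L^q(Ω)` norm. -/
def Lnorm {N : ℕ} (q : ℝ) (Ω : Set (Fin N → ℝ)) (v : (Fin N → ℝ) → ℝ) : ℝ :=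
  (∫ x in Ω, |v x| ^ q) ^ (1 / q)

lemma Ka_eq_pi {N : ℕ} (a : Fin N → ℝ) :
    Ka a = Set.pi Set.univ (fun j => Set.Ioo (-a j) (a j)) := by
  ext x; simp [Ka, abs_lt]

lemma closure_Ka {N : ℕ} (a : Fin N → ℝ) (ha : ∀ i, 0 < a i) :
    closure (Ka a) = Set.pi Set.univ (fun j => Set.Icc (-a j) (a j)) := by
  rw [Ka_eq_pi, closure_pi_set]
  congr 1; ext j : 1
  exact closure_Ioo (by have := ha j; linarith)

lemma isOpen_Ka {N : ℕ} (a : Fin N → ℝ) : IsOpen (Ka a) := by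
  rw [Ka_eq_pi]; exact isOpen_set_pi Set.finite_univ (fun j _ => isOpen_Ioo)

lemma isCompact_closure_Ka {N : ℕ} (a : Fin N → ℝ) (ha : ∀ i, 0 < a i) :
    IsCompact (closure (Ka a)) := by
  rw [closure_Ka a ha]; exact isCompact_univ_pi (fun j => isCompact_Icc)

lemma integrableOn_Ka {N : ℕ} (a : Fin N → ℝ) (ha : ∀ i, 0 < a i) {g : (Fin N → ℝ) → ℝ}
    (hg : ContinuousOn g (closure (Ka a))) : IntegrableOn g (Ka a) :=
  (hg.integrableOn_compact (isCompact_closure_Ka a ha)).mono_set subset_closure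

lemma update_mem_Ka {N : ℕ} {a : Fin N → ℝ} {x : Fin N → ℝ} (hx : x ∈ Ka a) {j : Fin N} {t : ℝ}
    (ht : t ∈ Set.Ioo (-a j) (a j)) : Function.update x j t ∈ Ka a := by
  intro k
  by_cases h : k = j
  · subst h; simpa [abs_lt] using ht
  · simpa [h] using hx k

lemma update_mem_clKa {N : ℕ} {a : Fin N → ℝ} (ha : ∀ i, 0 < a i) {x : Fin N → ℝ}
    (hx : x ∈ Ka a) {j : Fin N} {t : ℝ}
    (ht : t ∈ Set.Icc (-a j) (a j)) : Function.update x j t ∈ closure (Ka a) := by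
  rw [closure_Ka a ha]
  intro k _
  by_cases h : k = j
  · subst h; simpa using ht
  · have := abs_lt.1 (hx k)
    simp [h, this.1.le, this.2.le]

lemma update_mem_Ka_iff {N : ℕ} {a : Fin N → ℝ} {x : Fin N → ℝ} (hx : x ∈ Ka a) {j : Fin N}
    {t : ℝ} : Function.update x j t ∈ Ka a ↔ t ∈ Set.Ioo (-a j) (a j) := by
  refine ⟨fun h => ?_, update_mem_Ka hx⟩
  have := h j
  simpa [abs_lt] using this

lemma slice_continuousOn {N : ℕ} {a : Fin N → ℝ} (ha : ∀ i, 0 < a i) {g : (Fin N → ℝ) → ℝ}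
    (hg : ContinuousOn g (closure (Ka a))) {x : Fin N → ℝ} (hx : x ∈ Ka a) (j : Fin N) :
    ContinuousOn (fun t => g (Function.update x j t)) (Set.Icc (-a j) (a j)) := by
  refine hg.comp (Continuous.continuousOn (by fun_prop)) ?_
  intro t ht
  exact update_mem_clKa ha hx ht

lemma slice_integrableOn {N : ℕ} {a : Fin N → ℝ} (ha : ∀ i, 0 < a i) {g : (Fin N → ℝ) → ℝ}
    (hg : ContinuousOn g (closure (Ka a))) {x : Fin N → ℝ} (hx : x ∈ Ka a) (j : Fin N) :
    IntegrableOn (fun t => g (Function.update x j t)) (Set.Ioo (-a j) (a j)) :=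
  ((slice_continuousOn ha hg hx j).integrableOn_compact isCompact_Icc).mono_set
    Set.Ioo_subset_Icc_self

/-- the indicator function of `g` on `Ka a` as an `ENNReal` valued function -/
noncomputable def indE {N : ℕ} (a : Fin N → ℝ) (g : (Fin N → ℝ) → ℝ) : (Fin N → ℝ) → ENNReal :=
  (Ka a).indicator (fun x => ENNReal.ofReal (g x))

lemma measurable_indE {N : ℕ} (a : Fin N → ℝ) {g : (Fin N → ℝ) → ℝ}
    (hg : ContinuousOn g (closure (Ka a))) : Measurable (indE a g) := by
  unfold indE
  classical
  rw [← Set.piecewise_eq_indicator]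
  apply ContinuousOn.measurable_piecewise
  · exact ENNReal.continuous_ofReal.comp_continuousOn (hg.mono subset_closure)
  · exact continuousOn_const
  · exact (isOpen_Ka a).measurableSet

lemma lintegral_indE {N : ℕ} (a : Fin N → ℝ) (ha : ∀ i, 0 < a i) {g : (Fin N → ℝ) → ℝ}
    (hg : ContinuousOn g (closure (Ka a))) (h0 : ∀ x ∈ Ka a, 0 ≤ g x) :
    ∫⁻ x, indE a g x = ENNReal.ofReal (∫ x in Ka a, g x) := by
  unfold indE
  rw [lintegral_indicator (isOpen_Ka a).measurableSet,
    ofReal_integral_eq_lintegral_ofReal (integrableOn_Ka a ha hg)]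
  exact (ae_restrict_iff' (isOpen_Ka a).measurableSet).2 (Filter.Eventually.of_forall h0)

lemma lintegral_slice_indE {N : ℕ} (a : Fin N → ℝ) (ha : ∀ i, 0 < a i) {g : (Fin N → ℝ) → ℝ}
    (hg : ContinuousOn g (closure (Ka a))) (h0 : ∀ x ∈ Ka a, 0 ≤ g x) {x : Fin N → ℝ}
    (hx : x ∈ Ka a) (j : Fin N) :
    ∫⁻ t, indE a g (Function.update x j t)
      = ENNReal.ofReal (∫ t in Set.Ioo (-a j) (a j), g (Function.update x j t)) := by
  rw [ofReal_integral_eq_lintegral_ofReal (slice_integrableOn ha hg hx j),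
    ← lintegral_indicator measurableSet_Ioo]
  · congr 1; ext t
    unfold indE
    by_cases ht : t ∈ Set.Ioo (-a j) (a j)
    · rw [Set.indicator_of_mem ht, Set.indicator_of_mem (update_mem_Ka hx ht)]
    · rw [Set.indicator_of_notMem ht, Set.indicator_of_notMem]
      rwa [update_mem_Ka_iff hx]
  · exact (ae_restrict_iff' measurableSet_Ioo).2
      (Filter.Eventually.of_forall fun t ht => h0 _ (update_mem_Ka hx ht))

/-- comparison along fibers -/
lemma fiber_compare {N : ℕ} (a : Fin N → ℝ) (ha : ∀ i, 0 < a i) (j : Fin N)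
    {g₁ g₂ : (Fin N → ℝ) → ℝ}
    (h₁ : ContinuousOn g₁ (closure (Ka a))) (h₂ : ContinuousOn g₂ (closure (Ka a)))
    (p₁ : ∀ x ∈ Ka a, 0 ≤ g₁ x) (p₂ : ∀ x ∈ Ka a, 0 ≤ g₂ x)
    (h : ∀ x ∈ Ka a, ∫ t in Set.Ioo (-a j) (a j), g₁ (Function.update x j t) ≤
      ∫ t in Set.Ioo (-a j) (a j), g₂ (Function.update x j t)) :
    ∫ x in Ka a, g₁ x ≤ ∫ x in Ka a, g₂ x := by
  have key : ∫⁻ x, indE a g₁ x ≤ ∫⁻ x, indE a g₂ x := by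
    refine lintegral_le_of_lmarginal_le (μ := fun _ : Fin N => (volume : Measure ℝ)) {j}
      (measurable_indE a h₁) (measurable_indE a h₂) ?_
    intro x
    rw [lmarginal_singleton, lmarginal_singleton]
    by_cases hx : ∃ t, Function.update x j t ∈ Ka a
    · obtain ⟨t₀, ht₀⟩ := hx
      have s₁ := lintegral_slice_indE a ha h₁ p₁ ht₀ j
      have s₂ := lintegral_slice_indE a ha h₂ p₂ ht₀ j
      have h' := h _ ht₀
      simp only [Function.update_idem] at s₁ s₂ h'
      beta_reduce
      rw [s₁, s₂]
      exact ENNReal.ofReal_le_ofReal h'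
    · push Not at hx
      have : ∀ t, indE a g₁ (Function.update x j t) = 0 := fun t =>
        Set.indicator_of_notMem (hx t) _
      simp [this]
  rw [lintegral_indE a ha h₁ p₁, lintegral_indE a ha h₂ p₂] at key
  refine (ENNReal.ofReal_le_ofReal_iff ?_).1 key
  exact setIntegral_nonneg (isOpen_Ka a).measurableSet p₂

/-- Gagliardo inequality on the box -/
lemma gagliardo {N : ℕ} (hN : 2 ≤ N) (a : Fin N → ℝ) (ha : ∀ i, 0 < a i)
    {f F : (Fin N → ℝ) → ℝ}
    (hf : ContinuousOn f (closure (Ka a))) (hF : ContinuousOn F (closure (Ka a)))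
    (f0 : ∀ x ∈ Ka a, 0 ≤ f x) (F0 : ∀ x ∈ Ka a, 0 ≤ F x)
    (h : ∀ x ∈ Ka a, ∀ j, f x ≤ ∫ t in Set.Ioo (-a j) (a j), F (Function.update x j t)) :
    ∫ x in Ka a, (f x) ^ ((N : ℝ) / (N - 1)) ≤ (∫ x in Ka a, F x) ^ ((N : ℝ) / (N - 1)) := by
  have hN1 : (1 : ℝ) < N := by exact_mod_cast hN
  have hcard : (Fintype.card (Fin N) : ℝ) = N := by simp
  have hpos : 0 < (N : ℝ) / (N - 1) := div_pos (by linarith) (by linarith)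
  have hconj : Real.HolderConjugate (Fintype.card (Fin N)) ((N : ℝ) / (N - 1)) := by
    rw [hcard]
    exact Real.HolderConjugate.conjExponent hN1
  have base := lintegral_prod_lintegral_pow_le (fun _ : Fin N => (volume : Measure ℝ)) hconj
    (measurable_indE a hF)
  rw [hcard] at base
  have hfc : ContinuousOn (fun x => |f x| ^ ((N : ℝ) / (N - 1))) (closure (Ka a)) :=
    hf.abs.rpow_const (fun x _ => Or.inr hpos.le)
  have e1 : ∫ x in Ka a, (f x) ^ ((N : ℝ) / (N - 1)) =
      ∫ x in Ka a, |f x| ^ ((N : ℝ) / (N - 1)) :=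
    setIntegral_congr_fun (isOpen_Ka a).measurableSet
      (fun x hx => by simp only [abs_of_nonneg (f0 x hx)])
  have I0 : 0 ≤ ∫ x in Ka a, F x := setIntegral_nonneg (isOpen_Ka a).measurableSet F0
  rw [e1]
  refine (ENNReal.ofReal_le_ofReal_iff (Real.rpow_nonneg I0 _)).1 ?_
  rw [← lintegral_indE a ha hfc (fun x _ => by positivity),
    ← ENNReal.ofReal_rpow_of_nonneg I0 hpos.le, ← lintegral_indE a ha hF F0]
  refine le_trans ?_ base
  refine lintegral_mono fun x => ?_
  by_cases hx : x ∈ Ka a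
  · have : indE a (fun x => |f x| ^ ((N : ℝ) / (N - 1))) x
        = ∏ _j : Fin N, ENNReal.ofReal (f x) ^ (1 / ((N : ℝ) - 1)) := by
      unfold indE
      rw [Set.indicator_of_mem hx]
      beta_reduce
      rw [abs_of_nonneg (f0 x hx), Finset.prod_const, Finset.card_univ,
        Fintype.card_fin, ← ENNReal.ofReal_rpow_of_nonneg (f0 x hx) hpos.le,
        ← ENNReal.rpow_natCast, ← ENNReal.rpow_mul]
      congr 1; ring
    rw [this]
    refine Finset.prod_le_prod' fun j _ => ?_
    refine ENNReal.rpow_le_rpow ?_ (by apply div_nonneg <;> linarith)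
    rw [lintegral_slice_indE a ha hF F0 hx]
    exact ENNReal.ofReal_le_ofReal (h x hx j)
  · have : indE a (fun x => |f x| ^ ((N : ℝ) / (N - 1))) x = 0 := Set.indicator_of_notMem hx _
    rw [this]; exact zero_le

lemma AC_of_contDiffOn {g : ℝ → ℝ} {α β : ℝ} (hαβ : α < β)
    (hg : ContDiffOn ℝ 1 g (Set.Icc α β)) : AbsolutelyContinuousOnInterval g α β := by
  obtain ⟨K, hK⟩ := hg.exists_lipschitzOnWith one_ne_zero (convex_Icc α β) isCompact_Icc
  rw [← Set.uIcc_of_le hαβ.le] at hK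
  exact hK.absolutelyContinuousOnInterval

lemma AC_of_lip {g : ℝ → ℝ} {α β K : ℝ} (hαβ : α < β) 
    (hg : ∀ s ∈ Set.Icc α β, ∀ t ∈ Set.Icc α β, |g s - g t| ≤ K * |s - t|) :
    AbsolutelyContinuousOnInterval g α β := by
  have : LipschitzOnWith K.toNNReal g (Set.uIcc α β) := by
    rw [Set.uIcc_of_le hαβ.le]
    refine LipschitzOnWith.of_dist_le_mul fun s hs t ht => ?_
    rw [Real.dist_eq, Real.dist_eq]
    refine (hg s hs t ht).trans ?_
    gcongr
    exact Real.le_coe_toNNReal K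
  exact this.absolutelyContinuousOnInterval

lemma AC_comp {g Ψ : ℝ → ℝ} {α β : ℝ} (hg : AbsolutelyContinuousOnInterval g α β)
    (hΨ : ContDiff ℝ 1 Ψ) : AbsolutelyContinuousOnInterval (fun t => Ψ (g t)) α β := by
  obtain ⟨C, hC⟩ := hg.exists_bound
  obtain ⟨K, hK⟩ := (hΨ.contDiffOn (s := Metric.closedBall (0 : ℝ) C)).exists_lipschitzOnWith
    one_ne_zero (convex_closedBall 0 C) (isCompact_closedBall 0 C)
  rw [absolutelyContinuousOnInterval_iff] at hg ⊢
  intro ε hε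
  obtain ⟨δ, hδ, h⟩ := hg (ε / (K + 1)) (by positivity)
  refine ⟨δ, hδ, fun E hE hsum => ?_⟩
  have h1 := h E hE hsum
  have h2 : ∑ i ∈ Finset.range E.1, dist (Ψ (g (E.2 i).1)) (Ψ (g (E.2 i).2)) ≤
      ∑ i ∈ Finset.range E.1, (K + 1 : ℝ) * dist (g (E.2 i).1) (g (E.2 i).2) := by
    refine Finset.sum_le_sum fun i hi => ?_
    have hm := hE.1 i hi
    refine (hK.dist_le_mul _ ?_ _ ?_).trans ?_
    · simpa using hC _ hm.1
    · simpa using hC _ hm.2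
    · gcongr; linarith
  rw [← Finset.mul_sum] at h2
  refine h2.trans_lt ?_
  rw [lt_div_iff₀ (by positivity)] at h1
  linarith

lemma rpow_half_abs_le {ε v : ℝ} (hε : 0 < ε) : |v| ≤ (ε ^ 2 + v ^ 2) ^ (1 / 2 : ℝ) := by
  rw [← Real.sqrt_eq_rpow]
  apply Real.abs_le_sqrt
  nlinarith [sq_nonneg ε]

lemma Wpos {ε v : ℝ} (hε : 0 < ε) : 0 < ε ^ 2 + v ^ 2 := by positivity

lemma AC_power {k v : ℝ → ℝ} {α β ε : ℝ} (hε : 0 < ε)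
    (hk : AbsolutelyContinuousOnInterval k α β) (hv : AbsolutelyContinuousOnInterval v α β) :
    AbsolutelyContinuousOnInterval (fun t => (ε ^ 2 + v t ^ 2) ^ (k t)) α β := by
  have h1 : ContDiff ℝ 1 (fun s : ℝ => Real.log (ε ^ 2 + s ^ 2)) := by
    apply ContDiff.log
    · fun_prop
    · intro s; exact (Wpos hε).ne'
  have h2 := AC_comp ((AC_comp hv h1).fun_mul hk) (Real.contDiff_exp.of_le le_top)
  convert! h2 using 2 with t
  rw [Real.rpow_def_of_pos (Wpos hε)]

lemma deriv_k_bound {k : ℝ → ℝ} {α β K : ℝ} (hK : 0 ≤ K)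
    (hk : ∀ s ∈ Set.Icc α β, ∀ t ∈ Set.Icc α β, |k s - k t| ≤ K * |s - t|) {t : ℝ}
    (ht : t ∈ Set.Ioo α β) : |deriv k t| ≤ K := by
  rw [← Real.norm_eq_abs]
  apply norm_deriv_le_of_lip' hK
  filter_upwards [isOpen_Ioo.mem_nhds ht] with s hs
  exact hk s (Set.Ioo_subset_Icc_self hs) t (Set.Ioo_subset_Icc_self ht)

lemma deriv_power_bound {k v dv : ℝ → ℝ} {α β ε K : ℝ} (hε : 0 < ε) (hαβ : α < β) (hK : 0 ≤ K)
    (hk : ∀ s ∈ Set.Icc α β, ∀ t ∈ Set.Icc α β, |k s - k t| ≤ K * |s - t|)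
    (hdv : ∀ t ∈ Set.Ioo α β, HasDerivAt v (dv t) t) :
    ∀ᵐ t, t ∈ Set.Ioo α β → DifferentiableAt ℝ (fun t => (ε ^ 2 + v t ^ 2) ^ (k t)) t ∧
      |deriv (fun t => (ε ^ 2 + v t ^ 2) ^ (k t)) t| ≤
      K * (|Real.log (ε ^ 2 + v t ^ 2)| * (ε ^ 2 + v t ^ 2) ^ (k t)) +
      2 * |k t| * ((ε ^ 2 + v t ^ 2) ^ (k t - 1 / 2) * |dv t|) := by
  filter_upwards [(AC_of_lip hαβ hk).ae_differentiableAt] with t h ht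
  have hkt := (h (by rw [Set.uIcc_of_le hαβ.le]; exact Set.Ioo_subset_Icc_self ht)).hasDerivAt
  have hW := Wpos hε (v := v t)
  have hd := HasDerivAt.rpow (((hdv t ht).pow 2).const_add (ε ^ 2)) hkt hW
  refine ⟨hd.differentiableAt, ?_⟩
  have hd' := hd.deriv
  simp only [Pi.pow_apply] at hd'
  rw [hd']
  have hb := deriv_k_bound hK hk ht
  set W := ε ^ 2 + v t ^ 2 with hWd
  have hv : |v t| ≤ W ^ (1 / 2 : ℝ) := rpow_half_abs_le hε
  have e1 : W ^ (k t - 1 / 2) = W ^ (1 / 2 : ℝ) * W ^ (k t - 1) := by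
    rw [← Real.rpow_add hW]; congr 1; ring
  have p1 : 0 ≤ W ^ (k t - 1) := by positivity
  have p2 : 0 ≤ W ^ (k t) := by positivity
  refine (abs_add_le _ _).trans ?_
  rw [add_comm]
  refine add_le_add ?_ ?_
  · rw [abs_mul, abs_mul, abs_of_nonneg p2, mul_assoc, mul_comm (W ^ k t)]
    gcongr
  · rw [abs_mul, abs_mul, abs_of_nonneg p1, e1]
    have : |(2 : ℕ) * v t ^ (2 - 1) * dv t| = 2 * (|v t| * |dv t|) := by
      simp [abs_mul]; ring
    rw [this]
    calc 2 * (|v t| * |dv t|) * |k t| * W ^ (k t - 1)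
        ≤ 2 * (W ^ (1 / 2 : ℝ) * |dv t|) * |k t| * W ^ (k t - 1) := by gcongr
      _ = _ := by ring

/-- one dimensional sup bound -/
lemma sup_bound_1d {f G : ℝ → ℝ} {α β : ℝ} (hαβ : α < β)
    (hf : AbsolutelyContinuousOnInterval f α β) (hG : ContinuousOn G (Set.Icc α β))
    (hG0 : ∀ t ∈ Set.Icc α β, 0 ≤ G t)
    (hd : ∀ᵐ t, t ∈ Set.Ioo α β → |deriv f t| ≤ G t) {x : ℝ} (hx : x ∈ Set.Icc α β) :
    f x ≤ (∫ t in Set.Ioo α β, (f t) / (β - α) + G t) := by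
  have hfc : ContinuousOn f (Set.Icc α β) := by
    have := hf.continuousOn
    rwa [Set.uIcc_of_le hαβ.le] at this
  obtain ⟨t₀, ht₀, hmin⟩ := isCompact_Icc.exists_isMinOn ⟨α, Set.left_mem_Icc.2 hαβ.le⟩ hfc
  have hfi : IntegrableOn f (Set.Ioo α β) :=
    (hfc.integrableOn_compact isCompact_Icc).mono_set Set.Ioo_subset_Icc_self
  have hGi : IntegrableOn G (Set.Ioo α β) :=
    (hG.integrableOn_compact isCompact_Icc).mono_set Set.Ioo_subset_Icc_self
  rw [integral_add (hfi.div_const _) hGi, integral_div]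
  have h1 : f t₀ ≤ (∫ t in Set.Ioo α β, f t) / (β - α) := by
    rw [le_div_iff₀ (by linarith)]
    have : ∫ t in Set.Ioo α β, f t₀ ≤ ∫ t in Set.Ioo α β, f t :=
      setIntegral_mono_on (by simp) hfi measurableSet_Ioo
        (fun t ht => hmin (Set.Ioo_subset_Icc_self ht))
    simpa [Measure.real, hαβ.le, mul_comm] using this
  have hsub : Set.uIcc t₀ x ⊆ Set.Icc α β := Set.uIcc_subset_Icc ht₀ hx
  have h2 : f x - f t₀ ≤ ∫ t in Set.Ioo α β, G t := by
    rw [← (hf.mono (by rwa [Set.uIcc_of_le hαβ.le])).integral_deriv_eq_sub]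
    refine (Real.le_norm_self _).trans ?_
    refine (intervalIntegral.norm_integral_le_integral_norm_uIoc).trans ?_
    have hsub2 : Set.uIoc t₀ x ⊆ Set.Icc α β := Set.uIoc_subset_uIcc.trans hsub
    rw [← integral_Icc_eq_integral_Ioo]
    have hGi' : IntegrableOn G (Set.Icc α β) := hG.integrableOn_compact isCompact_Icc
    calc ∫ t in Set.uIoc t₀ x, ‖deriv f t‖ ≤ ∫ t in Set.uIoc t₀ x, G t := by
          refine setIntegral_mono_on_ae ?_ (hGi'.mono_set hsub2) measurableSet_uIoc ?_
          · have := (hf.mono (c := t₀) (d := x)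
              (by rwa [Set.uIcc_of_le hαβ.le])).intervalIntegrable_deriv
            rw [intervalIntegrable_iff] at this
            exact this.norm
          · have hne : ∀ᵐ t : ℝ, t ∉ ({α, β} : Set ℝ) :=
              (Set.Finite.countable (by simp)).ae_notMem _
            filter_upwards [hd, hne] with t ht hn htt
            have hm := hsub2 htt
            simp only [Set.mem_insert_iff, Set.mem_singleton_iff, not_or] at hn
            exact ht ⟨lt_of_le_of_ne hm.1 (Ne.symm hn.1), lt_of_le_of_ne hm.2 hn.2⟩
      _ ≤ ∫ t in Set.Icc α β, G t := by
          refine setIntegral_mono_set hGi' ?_ hsub2.eventuallyLE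
          exact (ae_restrict_iff' measurableSet_Icc).2 (Filter.Eventually.of_forall hG0)
  linarith

/-- one dimensional integration by parts inequality -/
lemma ibp_1d {φ U V G : ℝ → ℝ} {α β : ℝ} (hαβ : α < β)
    (hφ : AbsolutelyContinuousOnInterval φ α β) (hU : AbsolutelyContinuousOnInterval U α β)
    (hG : ContinuousOn G (Set.Icc α β))
    (hd : ∀ᵐ t, t ∈ Set.Ioo α β → |deriv φ t| ≤ G t)
    (hUV : ∀ t ∈ Set.Ioo α β, HasDerivAt U (V t) t) (hα : U α = 0) (hβ : U β = 0) :
    ∫ t in Set.Ioo α β, φ t * V t ≤ ∫ t in Set.Ioo α β, |U t| * G t := by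
  have hUc : ContinuousOn U (Set.Icc α β) := by
    have := hU.continuousOn
    rwa [Set.uIcc_of_le hαβ.le] at this
  have h1 := hφ.integral_mul_deriv_eq_deriv_mul hU
  rw [hα, hβ, intervalIntegral.integral_of_le hαβ.le, intervalIntegral.integral_of_le hαβ.le,
    integral_Ioc_eq_integral_Ioo, integral_Ioc_eq_integral_Ioo] at h1
  have h2 : ∫ t in Set.Ioo α β, φ t * V t = ∫ t in Set.Ioo α β, φ t * deriv U t :=
    setIntegral_congr_fun measurableSet_Ioo (fun t ht => by simp only [(hUV t ht).deriv])
  rw [h2, h1]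
  simp only [mul_zero, sub_zero, zero_sub]
  rw [← integral_neg]
  refine setIntegral_mono_on_ae ?_ ?_ measurableSet_Ioo ?_
  · have := hφ.intervalIntegrable_deriv.mul_continuousOn hU.continuousOn
    rw [intervalIntegrable_iff, Set.uIoc_of_le hαβ.le] at this
    exact (this.mono_set Set.Ioo_subset_Ioc_self).neg
  · exact ((hUc.abs.mul hG).integrableOn_compact isCompact_Icc).mono_set Set.Ioo_subset_Icc_self
  · filter_upwards [hd] with t ht htt
    calc -(deriv φ t * U t) ≤ |-(deriv φ t * U t)| := le_abs_self _
      _ = |U t| * |deriv φ t| := by rw [abs_neg, abs_mul, mul_comm]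
      _ ≤ _ := by gcongr; exact ht htt

lemma memLp_Ka {N : ℕ} (a : Fin N → ℝ) (ha : ∀ i, 0 < a i) {g : (Fin N → ℝ) → ℝ}
    (hg : ContinuousOn g (closure (Ka a))) (p : ENNReal) :
    MemLp g p (volume.restrict (Ka a)) := by
  obtain ⟨C, hC⟩ := (isCompact_closure_Ka a ha).exists_bound_of_continuousOn hg
  have : IsFiniteMeasure (volume.restrict (Ka a)) := by
    constructor
    rw [Measure.restrict_apply_univ]
    exact (measure_mono subset_closure).trans_lt (isCompact_closure_Ka a ha).measure_lt_top
  refine MemLp.of_bound (integrableOn_Ka a ha hg).aestronglyMeasurable C ?_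
  exact (ae_restrict_iff' (isOpen_Ka a).measurableSet).2
    (Filter.Eventually.of_forall fun x hx => hC x (subset_closure hx))

lemma holder_Ka {N : ℕ} (a : Fin N → ℝ) (ha : ∀ i, 0 < a i) {g h : (Fin N → ℝ) → ℝ} {p q : ℝ}
    (hpq : p.HolderConjugate q)
    (hg : ContinuousOn g (closure (Ka a))) (hh : ContinuousOn h (closure (Ka a)))
    (g0 : ∀ x ∈ Ka a, 0 ≤ g x) (h0 : ∀ x ∈ Ka a, 0 ≤ h x) :
    ∫ x in Ka a, g x * h x ≤
      (∫ x in Ka a, g x ^ p) ^ (1 / p) * (∫ x in Ka a, h x ^ q) ^ (1 / q) := by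
  apply integral_mul_le_Lp_mul_Lq_of_nonneg hpq
  · exact (ae_restrict_iff' (isOpen_Ka a).measurableSet).2 (Filter.Eventually.of_forall g0)
  · exact (ae_restrict_iff' (isOpen_Ka a).measurableSet).2 (Filter.Eventually.of_forall h0)
  · exact memLp_Ka a ha hg _
  · exact memLp_Ka a ha hh _

lemma cs_Ka {N : ℕ} (a : Fin N → ℝ) (ha : ∀ i, 0 < a i) {g h : (Fin N → ℝ) → ℝ}
    (hg : ContinuousOn g (closure (Ka a))) (hh : ContinuousOn h (closure (Ka a)))
    (g0 : ∀ x ∈ Ka a, 0 ≤ g x) (h0 : ∀ x ∈ Ka a, 0 ≤ h x) :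
    ∫ x in Ka a, g x * h x ≤
      (∫ x in Ka a, g x ^ 2) ^ (1 / 2 : ℝ) * (∫ x in Ka a, h x ^ 2) ^ (1 / 2 : ℝ) := by
  have := holder_Ka a ha (p := 2) (q := 2) (by constructor <;> norm_num) hg hh g0 h0
  simpa using this

/-- lower powers are absorbed by higher powers -/
lemma absorb_power {r ρ Pm η K : ℝ} (hr : 0 ≤ r) (hrρ : r < ρ) (hη : 0 < η) (hK : 0 < K) :
    ∃ C, 0 ≤ C ∧ ∀ W p : ℝ, 0 < W → 0 ≤ p → p ≤ Pm →
      K * W ^ ((p + r) / 2) ≤ η * W ^ ((p + ρ) / 2) + C := by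
  set W₀ := max 1 ((K / η) ^ (2 / (ρ - r))) with hW₀
  have hd : 0 < ρ - r := by linarith
  refine ⟨K * W₀ ^ ((Pm + r) / 2), by positivity, fun W p hW hp hpm => ?_⟩
  have h1 : 1 ≤ W₀ := le_max_left _ _
  by_cases h : W ≤ W₀
  · have : W ^ ((p + r) / 2) ≤ W₀ ^ ((Pm + r) / 2) :=
      (Real.rpow_le_rpow hW.le h (by linarith)).trans
        (Real.rpow_le_rpow_of_exponent_le h1 (by linarith))
    have h3 : 0 ≤ η * W ^ ((p + ρ) / 2) := by positivity
    nlinarith [mul_le_mul_of_nonneg_left this hK.le]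
  · push Not at h
    have h2 : (K / η) ^ (2 / (ρ - r)) ≤ W := (le_max_right _ _).trans h.le
    have h3 : K / η ≤ W ^ ((ρ - r) / 2) := by
      have := Real.rpow_le_rpow (by positivity) h2 (z := (ρ - r) / 2) (by linarith)
      rw [← Real.rpow_mul (by positivity)] at this
      have e : 2 / (ρ - r) * ((ρ - r) / 2) = 1 := by field_simp
      rwa [e, Real.rpow_one] at this
    have e2 : W ^ ((p + ρ) / 2) = W ^ ((ρ - r) / 2) * W ^ ((p + r) / 2) := by
      rw [← Real.rpow_add hW]; congr 1; ring
    rw [div_le_iff₀ hη] at h3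
    rw [e2]
    have h4 : 0 ≤ W ^ ((p + r) / 2) := by positivity
    have h5 : 0 ≤ K * W₀ ^ ((Pm + r) / 2) := by positivity
    nlinarith [mul_le_mul_of_nonneg_right h3 h4]

lemma absorb_log {ρ Pm η : ℝ} (hρ : 0 < ρ) (hη : 0 < η) :
    ∃ C, 0 ≤ C ∧ ∀ W p : ℝ, 0 < W → 1 ≤ p → p ≤ Pm →
      W ^ (p / 2) * (1 + Real.log W ^ 2) ≤ η * W ^ ((p + ρ) / 2) + C := by
  -- bound `1 + log²` by powers
  set K : ℝ := 1 + (8 / ρ) ^ 2 with hKd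
  obtain ⟨C, hC0, hC⟩ := absorb_power (r := ρ / 2) (ρ := ρ) (Pm := Pm) (η := η) (K := K)
    (by linarith) (by linarith) hη (by positivity)
  refine ⟨C + 17, by linarith, fun W p hW hp hpm => ?_⟩
  have hX : 0 ≤ η * W ^ ((p + ρ) / 2) := by positivity
  by_cases h : W ≤ 1
  · have h1 : W ^ (p / 2) ≤ W ^ (1 / 2 : ℝ) :=
      Real.rpow_le_rpow_of_exponent_ge hW h (by linarith)
    have h2 : W ^ (1 / 2 : ℝ) ≤ 1 := Real.rpow_le_one hW.le h (by norm_num)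
    have h3 := Real.abs_log_mul_self_rpow_lt W (1 / 4) hW h (by norm_num)
    have h4 : W ^ (1 / 2 : ℝ) = W ^ (1 / 4 : ℝ) * W ^ (1 / 4 : ℝ) := by
      rw [← Real.rpow_add hW]; norm_num
    have h5 : W ^ (1 / 2 : ℝ) * Real.log W ^ 2 ≤ 16 := by
      have : W ^ (1 / 2 : ℝ) * Real.log W ^ 2 = |Real.log W * W ^ (1 / 4 : ℝ)| ^ 2 := by
        rw [sq_abs, h4]; ring
      rw [this]
      have h6 := abs_nonneg (Real.log W * W ^ (1 / 4 : ℝ))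
      norm_num at h3 h6 ⊢
      nlinarith
    have h7 : W ^ (p / 2) * (1 + Real.log W ^ 2) ≤ W ^ (1 / 2 : ℝ) * (1 + Real.log W ^ 2) := by
      gcongr
    nlinarith
  · push Not at h
    have hl : Real.log W ≤ W ^ (ρ / 8) / (ρ / 8) := Real.log_le_rpow_div hW.le (by linarith)
    have hl0 : 0 ≤ Real.log W := Real.log_nonneg h.le
    have e8 : W ^ (ρ / 4) = W ^ (ρ / 8) * W ^ (ρ / 8) := by
      rw [← Real.rpow_add hW]; congr 1; ring
    have h1 : 1 ≤ W ^ (ρ / 4) := Real.one_le_rpow h.le (by linarith)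
    have h2 : Real.log W ^ 2 ≤ (8 / ρ) ^ 2 * W ^ (ρ / 4) := by
      have := pow_le_pow_left₀ hl0 hl 2
      refine this.trans (le_of_eq ?_)
      rw [e8]; field_simp; 
    have h3 : 1 + Real.log W ^ 2 ≤ K * W ^ (ρ / 4) := by rw [hKd]; nlinarith
    have e : W ^ ((p + ρ / 2) / 2) = W ^ (p / 2) * W ^ (ρ / 4) := by
      rw [← Real.rpow_add hW]; congr 1; ring
    have h4 := hC W p hW (by linarith) hpm
    rw [e] at h4
    have h5 : 0 ≤ W ^ (p / 2) := by positivity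
    nlinarith [mul_le_mul_of_nonneg_left h3 h5]

lemma final_algebra {s K A X : ℝ} (hs1 : s < 1) (hK : 0 < K) (hA : 0 < A)
    (hX : 0 ≤ X) (h : X ≤ K * A ^ (1 - s) * X ^ s) : X ≤ K ^ (1 / (1 - s)) * A := by
  rcases hX.eq_or_lt with h0 | h0
  · rw [← h0]; positivity
  have hs : 0 < 1 - s := by linarith
  have e : X = X ^ (1 - s) * X ^ s := by
    rw [← Real.rpow_add h0]; simp
  have h1 : X ^ (1 - s) ≤ K * A ^ (1 - s) := by
    have hp : 0 < X ^ s := by positivity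
    refine le_of_mul_le_mul_right ?_ hp
    rw [← e]; exact h
  have h2 := Real.rpow_le_rpow (by positivity) h1 (z := 1 / (1 - s)) (by positivity)
  rw [← Real.rpow_mul h0.le, mul_one_div_cancel hs.ne', Real.rpow_one,
    Real.mul_rpow hK.le (by positivity), ← Real.rpow_mul hA.le, mul_one_div_cancel hs.ne',
    Real.rpow_one] at h2
  exact h2

/-- The abstract data used in the core estimate. -/
structure Dat {N : ℕ} (a : Fin N → ℝ) (i : Fin N) (L Pm M₀ ε : ℝ)
    (P u v : (Fin N → ℝ) → ℝ) (dv : Fin N → (Fin N → ℝ) → ℝ) : Prop where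
  ε0 : 0 < ε
  ε1 : ε < 1
  P1 : ∀ x ∈ closure (Ka a), 1 ≤ P x
  Pm : ∀ x ∈ closure (Ka a), P x ≤ Pm
  cP : ContinuousOn P (closure (Ka a))
  cu : ContinuousOn u (closure (Ka a))
  cv : ContinuousOn v (closure (Ka a))
  cdv : ∀ j, ContinuousOn (dv j) (closure (Ka a))
  lip : ∀ x ∈ Ka a, ∀ j, ∀ s ∈ Set.Icc (-a j) (a j), ∀ t ∈ Set.Icc (-a j) (a j),
    |P (Function.update x j s) - P (Function.update x j t)| ≤ L * |s - t|
  acu : ∀ x ∈ Ka a,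
    AbsolutelyContinuousOnInterval (fun t => u (Function.update x i t)) (-a i) (a i)
  acv : ∀ x ∈ Ka a, ∀ j,
    AbsolutelyContinuousOnInterval (fun t => v (Function.update x j t)) (-a j) (a j)
  du : ∀ x ∈ Ka a, ∀ t ∈ Set.Ioo (-a i) (a i),
    HasDerivAt (fun t => u (Function.update x i t)) (v (Function.update x i t)) t
  dv : ∀ x ∈ Ka a, ∀ j, ∀ t ∈ Set.Ioo (-a j) (a j),
    HasDerivAt (fun t => v (Function.update x j t)) (dv j (Function.update x j t)) t
  bl : ∀ x ∈ Ka a, u (Function.update x i (-a i)) = 0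
  br : ∀ x ∈ Ka a, u (Function.update x i (a i)) = 0
  mass : ∫ x in Ka a, u x ^ 2 ≤ M₀ ^ 2

lemma cont_pow {N : ℕ} {s : Set (Fin N → ℝ)} {ε : ℝ} {v e : (Fin N → ℝ) → ℝ} (hε : 0 < ε)
    (hv : ContinuousOn v s) (he : ContinuousOn e s) :
    ContinuousOn (fun x => (ε ^ 2 + v x ^ 2) ^ (e x)) s := by
  refine ContinuousOn.rpow (by fun_prop) he ?_
  intro x _
  exact Or.inl (Wpos hε).ne'

lemma cont_logW {N : ℕ} {s : Set (Fin N → ℝ)} {ε : ℝ} {v : (Fin N → ℝ) → ℝ} (hε : 0 < ε)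
    (hv : ContinuousOn v s) :
    ContinuousOn (fun x => Real.log (ε ^ 2 + v x ^ 2)) s := by
  refine ContinuousOn.log (by fun_prop) ?_
  intro x _
  exact (Wpos hε).ne'

noncomputable def Sfun {N : ℕ} (ε : ℝ) (P v : (Fin N → ℝ) → ℝ) (dv : Fin N → (Fin N → ℝ) → ℝ)
    (x : Fin N → ℝ) : ℝ :=
  (ε ^ 2 + v x ^ 2) ^ ((P x - 2) / 4) * ∑ j, |dv j x| +
    (ε ^ 2 + v x ^ 2) ^ (P x / 4) * (1 + |Real.log (ε ^ 2 + v x ^ 2)|)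

lemma Sfun_nonneg {N : ℕ} {ε : ℝ} (hε : 0 < ε) (P v : (Fin N → ℝ) → ℝ)
    (dv : Fin N → (Fin N → ℝ) → ℝ) (x : Fin N → ℝ) : 0 ≤ Sfun ε P v dv x := by
  have := Wpos hε (v := v x)
  unfold Sfun; positivity

lemma Sfun_cont {N : ℕ} {s : Set (Fin N → ℝ)} {ε : ℝ} (hε : 0 < ε) {P v : (Fin N → ℝ) → ℝ}
    {dv : Fin N → (Fin N → ℝ) → ℝ} (hP : ContinuousOn P s) (hv : ContinuousOn v s)
    (hdv : ∀ j, ContinuousOn (dv j) s) : ContinuousOn (Sfun ε P v dv) s := by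
  unfold Sfun
  have h1 := cont_logW hε hv
  have h2 : ContinuousOn (fun x => ∑ j, |dv j x|) s :=
    continuousOn_finsetSum _ (fun j _ => (hdv j).abs)
  exact ((cont_pow hε hv (by fun_prop)).mul h2).add
    ((cont_pow hε hv (by fun_prop)).mul (continuousOn_const.add h1.abs))

lemma pointwise_LW {W p Pm ρ L c s d D : ℝ} (hW : 0 < W) (hp : 1 ≤ p) (hpm : p ≤ Pm) (hρ : 0 < ρ)
    (hρ1 : ρ ≤ 1) (hL : 0 ≤ L) (hc : 1 / c ≤ s) (hs : 0 ≤ s) (hd : 0 ≤ d) (hdD : d ≤ D) :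
    W ^ ((p + ρ / 2) / 2) / c + (L / 2 * (|Real.log W| * W ^ ((p + ρ / 2) / 2)) +
      2 * |(p + ρ / 2) / 2| * (W ^ ((p + ρ / 2) / 2 - 1 / 2) * d)) ≤
    (s + L / 2 + Pm + 1) * ((W ^ ((p - 2) / 4) * D + W ^ (p / 4) * (1 + |Real.log W|)) *
      W ^ ((p + ρ) / 4)) := by
  have e1 : W ^ ((p + ρ / 2) / 2) = W ^ (p / 4) * W ^ ((p + ρ) / 4) := by
    rw [← Real.rpow_add hW]; congr 1; ring
  have e2 : W ^ ((p + ρ / 2) / 2 - 1 / 2) = W ^ ((p - 2) / 4) * W ^ ((p + ρ) / 4) := by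
    rw [← Real.rpow_add hW]; congr 1; ring
  rw [e1, e2, abs_of_nonneg (by positivity : (0:ℝ) ≤ (p + ρ / 2) / 2)]
  have hl := abs_nonneg (Real.log W)
  have hB : 0 < W ^ (p / 4) := by positivity
  have hR : 0 < W ^ ((p + ρ) / 4) := by positivity
  have hQ : 0 < W ^ ((p - 2) / 4) := by positivity
  generalize W ^ (p / 4) = B at *
  generalize W ^ ((p + ρ) / 4) = R at *
  generalize W ^ ((p - 2) / 4) = Q at *
  generalize |Real.log W| = l at *
  have hBR : 0 ≤ B * R := by positivity
  have h1 : B * R / c ≤ s * (B * R) := by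
    rw [div_eq_mul_one_div, mul_comm]; gcongr
  have h2 : 2 * ((p + ρ / 2) / 2) * (Q * R * d) ≤ (Pm + 1) * (Q * R * D) := by
    have : 2 * ((p + ρ / 2) / 2) ≤ Pm + 1 := by linarith
    gcongr
    linarith
  have hD : 0 ≤ D := hd.trans hdD
  have hPm : 0 ≤ Pm := by linarith
  have : (s + L / 2 + Pm + 1) * ((Q * D + B * (1 + l)) * R) =
    s * (B * R) + L / 2 * (l * (B * R)) + (Pm + 1) * (Q * R * D) +
    (s * (Q * R * D) + s * (l * (B * R)) + L / 2 * (Q * R * D) + L / 2 * (B * R) +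
      (Pm + 1) * (B * R) + (Pm + 1) * (l * (B * R))) := by ring
  rw [this]
  have : 0 ≤ (s * (Q * R * D) + s * (l * (B * R)) + L / 2 * (Q * R * D) + L / 2 * (B * R) +
      (Pm + 1) * (B * R) + (Pm + 1) * (l * (B * R))) := by positivity
  linarith

lemma LW_est {N : ℕ} (hN : 2 ≤ N) {a : Fin N → ℝ} (ha : ∀ i, 0 < a i) {i : Fin N}
    {L Pm M₀ ε ρ : ℝ} (hL : 0 ≤ L) (hρ : 0 < ρ) (hρ1 : ρ ≤ 1)
    {P u v : (Fin N → ℝ) → ℝ} {dv : Fin N → (Fin N → ℝ) → ℝ} (D : Dat a i L Pm M₀ ε P u v dv)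
    (hPm : 0 ≤ Pm) :
    ∫ x in Ka a, ((ε ^ 2 + v x ^ 2) ^ ((P x + ρ / 2) / 2)) ^ ((N : ℝ) / (N - 1)) ≤
    ((∑ j, 1 / (2 * a j) + L / 2 + Pm + 1) * ((∫ x in Ka a, Sfun ε P v dv x ^ 2) ^ (1 / 2 : ℝ) *
      (∫ x in Ka a, (ε ^ 2 + v x ^ 2) ^ ((P x + ρ) / 2)) ^ (1 / 2 : ℝ))) ^ ((N : ℝ) / (N - 1)) := by
  have hε := D.ε0
  have cP := D.cP
  have cv := D.cv
  have hs0 : 0 ≤ ∑ j, 1 / (2 * a j) := Finset.sum_nonneg fun j _ => by have := ha j; positivity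
  set C1 := ∑ j, 1 / (2 * a j) + L / 2 + Pm + 1 with hC1
  have hC10 : 0 ≤ C1 := by positivity
  have cS := Sfun_cont hε cP cv D.cdv
  have cR : ContinuousOn (fun x => (ε ^ 2 + v x ^ 2) ^ ((P x + ρ) / 4)) (closure (Ka a)) :=
    cont_pow hε cv (by fun_prop)
  have cf : ContinuousOn (fun x => (ε ^ 2 + v x ^ 2) ^ ((P x + ρ / 2) / 2)) (closure (Ka a)) :=
    cont_pow hε cv (by fun_prop)
  have cF : ContinuousOn (fun x => C1 * (Sfun ε P v dv x * (ε ^ 2 + v x ^ 2) ^ ((P x + ρ) / 4)))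
    (closure (Ka a)) := continuousOn_const.mul (cS.mul cR)
  have hWp : ∀ x, 0 < ε ^ 2 + v x ^ 2 := fun x => Wpos hε
  have hS0 := Sfun_nonneg hε P v dv
  have hN1 : (1 : ℝ) < N := by exact_mod_cast hN
  refine (gagliardo hN a ha cf cF (fun x _ => by have := hWp x; positivity)
    (fun x _ => by have := hWp x; have := hS0 x; positivity) ?_).trans ?_
  · intro x hx j
    have hj : -a j < a j := by have := ha j; linarith
    have hk : ∀ s ∈ Set.Icc (-a j) (a j), ∀ t ∈ Set.Icc (-a j) (a j),
        |(P (Function.update x j s) + ρ / 2) / 2 - (P (Function.update x j t) + ρ / 2) / 2|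
          ≤ L / 2 * |s - t| := by
      intro s hs t ht
      have := D.lip x hx j s hs t ht
      rw [show (P (Function.update x j s) + ρ / 2) / 2 - (P (Function.update x j t) + ρ / 2) / 2 =
        (P (Function.update x j s) - P (Function.update x j t)) / 2 by ring, abs_div,
        abs_of_pos (by norm_num : (0:ℝ) < 2)]
      linarith
    have hAC := AC_power hε (AC_of_lip hj hk) (D.acv x hx j)
    have hdp := deriv_power_bound hε hj (by positivity) hk (D.dv x hx j)
    have cG : ContinuousOn (fun y => L / 2 * (|Real.log (ε ^ 2 + v y ^ 2)| *
        (ε ^ 2 + v y ^ 2) ^ ((P y + ρ / 2) / 2)) + 2 * |(P y + ρ / 2) / 2| *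
        ((ε ^ 2 + v y ^ 2) ^ ((P y + ρ / 2) / 2 - 1 / 2) * |dv j y|)) (closure (Ka a)) := by
      have h1 := cont_logW hε cv
      have h2 : ContinuousOn (fun x => (ε ^ 2 + v x ^ 2) ^ ((P x + ρ / 2) / 2 - 1 / 2))
        (closure (Ka a)) := cont_pow hε cv (by fun_prop)
      have h3 := D.cdv j
      exact (continuousOn_const.mul (h1.abs.mul cf)).add
        ((continuousOn_const.mul (ContinuousOn.abs (by fun_prop))).mul (h2.mul h3.abs))
    have hsup := sup_bound_1d hj hAC (slice_continuousOn ha cG hx j)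
      (fun t ht => by have := hWp (Function.update x j t); positivity)
      (by filter_upwards [hdp] with t h ht using (h ht).2)
      (x := x j) (by have := abs_lt.1 (hx j); exact ⟨this.1.le, this.2.le⟩)
    simp only [Function.update_eq_self] at hsup
    refine hsup.trans ?_
    refine setIntegral_mono_on ?_ (slice_integrableOn ha cF hx j) measurableSet_Ioo ?_
    · exact ((slice_integrableOn ha cf hx j).div_const _).add (slice_integrableOn ha cG hx j)
    · intro t ht
      have hy := subset_closure (update_mem_Ka hx ht)
      have := pointwise_LW (hWp (Function.update x j t)) (D.P1 _ hy) (D.Pm _ hy) hρ hρ1 hL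
        (c := a j - -a j) (s := ∑ j, 1 / (2 * a j))
        (d := |dv j (Function.update x j t)|) (D := ∑ k, |dv k (Function.update x j t)|)
        (by
          rw [show a j - -a j = 2 * a j by ring]
          exact Finset.single_le_sum (f := fun j => 1 / (2 * a j))
            (fun j _ => by have := ha j; positivity) (Finset.mem_univ j)) hs0 (abs_nonneg _)
        (Finset.single_le_sum (f := fun k => |dv k (Function.update x j t)|)
            (fun j _ => abs_nonneg _) (Finset.mem_univ j))
      exact this
  · have h0 : 0 ≤ ∫ x in Ka a, C1 * (Sfun ε P v dv x * (ε ^ 2 + v x ^ 2) ^ ((P x + ρ) / 4)) :=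
      setIntegral_nonneg (isOpen_Ka a).measurableSet
        (fun x _ => by have := hWp x; have := hS0 x; positivity)
    refine Real.rpow_le_rpow h0 ?_ (div_nonneg (by linarith) (by linarith))
    rw [integral_const_mul]
    refine mul_le_mul_of_nonneg_left ?_ hC10
    refine (cs_Ka a ha cS cR (fun x _ => hS0 x) (fun x _ => by have := hWp x; positivity)).trans
      (le_of_eq ?_)
    congr 3
    ext x
    rw [← Real.rpow_mul_natCast (hWp x).le]
    congr 1; push_cast; ring

lemma pointwise_IBP {W p Pm L d D v z : ℝ} (hW : 0 < W) (hp : 1 ≤ p) (hpm : p ≤ Pm)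
    (hL : 0 ≤ L) (hd : 0 ≤ d) (hdD : d ≤ D) (hv : |v| ≤ W ^ (1 / 2 : ℝ))
    (hz : |z| ≤ L / 4 * (|Real.log W| * W ^ ((p - 2) / 4)) +
      2 * |(p - 2) / 4| * (W ^ ((p - 2) / 4 - 1 / 2) * d)) :
    |z| * |v| + W ^ ((p - 2) / 4) * d ≤ (L / 4 + (Pm + 2) / 2 + 1) *
      (W ^ ((p - 2) / 4) * D + W ^ (p / 4) * (1 + |Real.log W|)) := by
  have e1 : W ^ (p / 4) = W ^ ((p - 2) / 4) * W ^ (1 / 2 : ℝ) := by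
    rw [← Real.rpow_add hW]; congr 1; ring
  have e2 : W ^ ((p - 2) / 4) = W ^ ((p - 2) / 4 - 1 / 2) * W ^ (1 / 2 : ℝ) := by
    rw [← Real.rpow_add hW]; congr 1; ring
  have hk : 2 * |(p - 2) / 4| ≤ (Pm + 2) / 2 := by
    have : |(p - 2) / 4| ≤ (Pm + 2) / 4 := abs_le.2 ⟨by linarith, by linarith⟩
    linarith
  have hl := abs_nonneg (Real.log W)
  have h1 : |z| * |v| ≤ (L / 4 * (|Real.log W| * W ^ ((p - 2) / 4)) +
      2 * |(p - 2) / 4| * (W ^ ((p - 2) / 4 - 1 / 2) * d)) * W ^ (1 / 2 : ℝ) := by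
    gcongr
  have h2 : (L / 4 * (|Real.log W| * W ^ ((p - 2) / 4)) +
      2 * |(p - 2) / 4| * (W ^ ((p - 2) / 4 - 1 / 2) * d)) * W ^ (1 / 2 : ℝ) =
      L / 4 * (|Real.log W| * W ^ (p / 4)) + 2 * |(p - 2) / 4| * (W ^ ((p - 2) / 4) * d) := by
    rw [e1]
    linear_combination (-(2 * |(p - 2) / 4| * d)) * e2
  rw [h2] at h1
  have hB : 0 < W ^ (p / 4) := by positivity
  have hQ : 0 < W ^ ((p - 2) / 4) := by positivity
  clear h2 e1 e2 hz
  generalize W ^ (p / 4) = B at *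
  generalize W ^ ((p - 2) / 4) = Q at *
  generalize |Real.log W| = l at *
  have hD : 0 ≤ D := hd.trans hdD
  have hPm : 0 ≤ Pm := by linarith
  have h3 : 2 * |(p - 2) / 4| * (Q * d) ≤ (Pm + 2) / 2 * (Q * D) := by gcongr
  have h4 : Q * d ≤ Q * D := by gcongr
  have : (L / 4 + (Pm + 2) / 2 + 1) * (Q * D + B * (1 + l)) = 
    L / 4 * (l * B) + (Pm + 2) / 2 * (Q * D) + Q * D +
    (L / 4 * (Q * D) + L / 4 * B + ((Pm + 2) / 2 + 1) * (B * (1 + l))) := by ring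
  rw [this]
  have : 0 ≤ (L / 4 * (Q * D) + L / 4 * B + ((Pm + 2) / 2 + 1) * (B * (1 + l))) := by positivity
  linarith

lemma IBP_est {N : ℕ} {a : Fin N → ℝ} (ha : ∀ i, 0 < a i) {i : Fin N}
    {L Pm M₀ ε : ℝ} (hL : 0 ≤ L) (hM : 0 < M₀)
    {P u v : (Fin N → ℝ) → ℝ} {dv : Fin N → (Fin N → ℝ) → ℝ} (D : Dat a i L Pm M₀ ε P u v dv)
    (hPm : 0 ≤ Pm) :
    ∫ x in Ka a, (ε ^ 2 + v x ^ 2) ^ ((P x - 2) / 4) * v x ^ 2 ≤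
    (L / 4 + (Pm + 2) / 2 + 1) * (M₀ * (∫ x in Ka a, Sfun ε P v dv x ^ 2) ^ (1 / 2 : ℝ)) := by
  have hε := D.ε0
  have cP := D.cP
  have cv := D.cv
  have cu := D.cu
  set C2 := L / 4 + (Pm + 2) / 2 + 1 with hC2
  have hC20 : 0 ≤ C2 := by positivity
  have cS := Sfun_cont hε cP cv D.cdv
  have hWp : ∀ x, 0 < ε ^ 2 + v x ^ 2 := fun x => Wpos hε
  have hS0 := Sfun_nonneg hε P v dv
  have cQ : ContinuousOn (fun x => (ε ^ 2 + v x ^ 2) ^ ((P x - 2) / 4)) (closure (Ka a)) :=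
    cont_pow hε cv (by fun_prop)
  have c1 : ContinuousOn (fun x => (ε ^ 2 + v x ^ 2) ^ ((P x - 2) / 4) * v x ^ 2)
    (closure (Ka a)) := cQ.mul (cv.pow 2)
  have cCS : ContinuousOn (fun x => C2 * Sfun ε P v dv x) (closure (Ka a)) :=
    continuousOn_const.mul cS
  have c2 : ContinuousOn (fun x => |u x| * (C2 * Sfun ε P v dv x)) (closure (Ka a)) :=
    cu.abs.mul cCS
  have h := fiber_compare a ha i c1 c2 (fun x _ => by have := hWp x; positivity)
    (fun x _ => by have := hS0 x; positivity) ?_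
  · refine h.trans ?_
    have e : ∀ x, |u x| * (C2 * Sfun ε P v dv x) = C2 * (|u x| * Sfun ε P v dv x) :=
      fun x => by ring
    simp_rw [e]
    rw [integral_const_mul]
    refine mul_le_mul_of_nonneg_left ?_ hC20
    refine (cs_Ka a ha cu.abs cS (fun x _ => abs_nonneg _) (fun x _ => hS0 x)).trans ?_
    simp_rw [sq_abs]
    refine mul_le_mul_of_nonneg_right ?_ (by positivity)
    calc _ ≤ (M₀ ^ 2) ^ (1 / 2 : ℝ) := Real.rpow_le_rpow
            (setIntegral_nonneg (isOpen_Ka a).measurableSet (fun x _ => sq_nonneg _))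
            D.mass (by norm_num)
      _ = M₀ := by rw [← Real.sqrt_eq_rpow, Real.sqrt_sq hM.le]
  · intro x hx
    have hj : -a i < a i := by have := ha i; linarith
    have hk : ∀ s ∈ Set.Icc (-a i) (a i), ∀ t ∈ Set.Icc (-a i) (a i),
        |(P (Function.update x i s) - 2) / 4 - (P (Function.update x i t) - 2) / 4|
          ≤ L / 4 * |s - t| := by
      intro s hs t ht
      have := D.lip x hx i s hs t ht
      rw [show (P (Function.update x i s) - 2) / 4 - (P (Function.update x i t) - 2) / 4 =
        (P (Function.update x i s) - P (Function.update x i t)) / 4 by ring, abs_div,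
        abs_of_pos (by norm_num : (0:ℝ) < 4)]
      linarith
    have hAC := AC_power hε (AC_of_lip hj hk) (D.acv x hx i)
    have hdp := deriv_power_bound hε hj (by positivity) hk (D.dv x hx i)
    have hib := ibp_1d hj (hAC.fun_mul (D.acv x hx i)) (D.acu x hx)
      (slice_continuousOn ha cCS hx i) ?_ (D.du x hx) (D.bl x hx) (D.br x hx)
    · refine le_trans (le_of_eq ?_) hib
      refine setIntegral_congr_fun measurableSet_Ioo (fun t _ => ?_)
      ring
    · filter_upwards [hdp] with t h ht
      obtain ⟨h1, h2⟩ := h ht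
      have h3 := D.dv x hx i t ht
      have hy := subset_closure (update_mem_Ka hx ht)
      have hd := (h1.hasDerivAt.mul h3).deriv
      have hd' : deriv (fun t => (ε ^ 2 + v (Function.update x i t) ^ 2) ^
        ((P (Function.update x i t) - 2) / 4) * v (Function.update x i t)) t = _ := hd
      rw [hd']
      have := pointwise_IBP (hWp (Function.update x i t)) (D.P1 _ hy) (D.Pm _ hy) hL
        (d := |dv i (Function.update x i t)|) (D := ∑ j, |dv j (Function.update x i t)|)
        (abs_nonneg _)
        (Finset.single_le_sum (f := fun j => |dv j (Function.update x i t)|)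
            (fun j _ => abs_nonneg _) (Finset.mem_univ i)) (rpow_half_abs_le hε) h2
      refine ((abs_add_le _ _).trans ?_).trans this
      rw [abs_mul, abs_mul, abs_of_pos (a := (ε ^ 2 + v (Function.update x i t) ^ 2) ^
        ((P (Function.update x i t) - 2) / 4)) (by have := hWp (Function.update x i t); positivity)]

lemma pointwise_Z {ε v p Pm : ℝ} (hε : 0 < ε) (hε1 : ε < 1) (hp : 1 ≤ p) (hpm : p ≤ Pm) :
    (ε ^ 2 + v ^ 2) ^ ((p + 2) / 4) ≤
      2 * ((ε ^ 2 + v ^ 2) ^ ((p - 2) / 4) * v ^ 2) + (2 : ℝ) ^ ((Pm + 2) / 4) := by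
  have hW := Wpos hε (v := v)
  by_cases h : ε ^ 2 ≤ v ^ 2
  · have e : (ε ^ 2 + v ^ 2) ^ ((p + 2) / 4) =
        (ε ^ 2 + v ^ 2) ^ ((p - 2) / 4) * (ε ^ 2 + v ^ 2) := by
      rw [← Real.rpow_add_one hW.ne']; congr 1; ring
    rw [e]
    have h0 : 0 < (ε ^ 2 + v ^ 2) ^ ((p - 2) / 4) := by positivity
    have h1 : (0 : ℝ) < (2 : ℝ) ^ ((Pm + 2) / 4) := by positivity
    nlinarith
  · have h2 : ε ^ 2 + v ^ 2 ≤ 2 := by nlinarith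
    have h3 : (ε ^ 2 + v ^ 2) ^ ((p + 2) / 4) ≤ (2 : ℝ) ^ ((Pm + 2) / 4) := by
      calc _ ≤ (2 : ℝ) ^ ((p + 2) / 4) := Real.rpow_le_rpow hW.le h2 (by linarith)
        _ ≤ _ := Real.rpow_le_rpow_of_exponent_le (by norm_num) (by linarith)
    have : 0 ≤ 2 * ((ε ^ 2 + v ^ 2) ^ ((p - 2) / 4) * v ^ 2) := by positivity
    linarith

lemma integrableOn_const_Ka {N : ℕ} (a : Fin N → ℝ) (ha : ∀ i, 0 < a i) (c : ℝ) :
    IntegrableOn (fun _ => c) (Ka a) := integrableOn_Ka a ha continuousOn_const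

lemma setIntegral_const_Ka {N : ℕ} (a : Fin N → ℝ) (c : ℝ) :
    ∫ _ in Ka a, c = volume.real (Ka a) * c := by
  rw [setIntegral_const]; rfl

lemma Z_est {N : ℕ} {a : Fin N → ℝ} (ha : ∀ i, 0 < a i) {i : Fin N}
    {L Pm M₀ ε : ℝ} (hL : 0 ≤ L) (hM : 0 < M₀)
    {P u v : (Fin N → ℝ) → ℝ} {dv : Fin N → (Fin N → ℝ) → ℝ} (D : Dat a i L Pm M₀ ε P u v dv)
    (hPm : 0 ≤ Pm) :
    ∫ x in Ka a, (ε ^ 2 + v x ^ 2) ^ ((P x + 2) / 4) ≤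
    (2 * ((L / 4 + (Pm + 2) / 2 + 1) * M₀) + volume.real (Ka a) * (2 : ℝ) ^ ((Pm + 2) / 4)) *
      ((∫ x in Ka a, Sfun ε P v dv x ^ 2) + 1) ^ (1 / 2 : ℝ) := by
  have hε := D.ε0
  have cP := D.cP
  have cv := D.cv
  have hA0 : 0 ≤ ∫ x in Ka a, Sfun ε P v dv x ^ 2 :=
    setIntegral_nonneg (isOpen_Ka a).measurableSet (fun x _ => sq_nonneg _)
  have hi := IBP_est ha hL hM D hPm
  have cQ : ContinuousOn (fun x => (ε ^ 2 + v x ^ 2) ^ ((P x - 2) / 4)) (closure (Ka a)) :=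
    cont_pow hε cv (by fun_prop)
  have c1 : ContinuousOn (fun x => (ε ^ 2 + v x ^ 2) ^ ((P x - 2) / 4) * v x ^ 2)
    (closure (Ka a)) := cQ.mul (cv.pow 2)
  have c0 : ContinuousOn (fun x => (ε ^ 2 + v x ^ 2) ^ ((P x + 2) / 4)) (closure (Ka a)) :=
    cont_pow hε cv (by fun_prop)
  have h1 : ∫ x in Ka a, (ε ^ 2 + v x ^ 2) ^ ((P x + 2) / 4) ≤
      ∫ x in Ka a, (2 * ((ε ^ 2 + v x ^ 2) ^ ((P x - 2) / 4) * v x ^ 2) +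
        (2 : ℝ) ^ ((Pm + 2) / 4)) := by
    refine setIntegral_mono_on (integrableOn_Ka a ha c0)
      (integrableOn_Ka a ha ((continuousOn_const.mul c1).add continuousOn_const))
      (isOpen_Ka a).measurableSet ?_
    intro x hx
    exact pointwise_Z hε D.ε1 (D.P1 x (subset_closure hx)) (D.Pm x (subset_closure hx))
  rw [integral_add ((integrableOn_Ka a ha c1).const_mul _)
    (integrableOn_const_Ka a ha _), integral_const_mul, setIntegral_const_Ka] at h1
  generalize (∫ x in Ka a, Sfun ε P v dv x ^ 2) = A at *
  have h2 : A ^ (1 / 2 : ℝ) ≤ (A + 1) ^ (1 / 2 : ℝ) :=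
    Real.rpow_le_rpow hA0 (by linarith) (by norm_num)
  have h3 : 1 ≤ (A + 1) ^ (1 / 2 : ℝ) := Real.one_le_rpow (by linarith) (by norm_num)
  have hV : 0 ≤ volume.real (Ka a) * (2 : ℝ) ^ ((Pm + 2) / 4) := by positivity
  have hC : 0 ≤ (L / 4 + (Pm + 2) / 2 + 1) * M₀ := by positivity
  have h4 := mul_le_mul_of_nonneg_left h2 hC
  have h5 := mul_le_mul_of_nonneg_left h3 hV
  nlinarith

lemma Hol_est {N : ℕ} (hN : 2 ≤ N) {a : Fin N → ℝ} (ha : ∀ i, 0 < a i) {i : Fin N}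
    {L Pm M₀ ε ρ : ℝ} (hρ : ρ = 4 / (N + 2))
    {P u v : (Fin N → ℝ) → ℝ} {dv : Fin N → (Fin N → ℝ) → ℝ} (D : Dat a i L Pm M₀ ε P u v dv) :
    ∫ x in Ka a, (ε ^ 2 + v x ^ 2) ^ ((P x + ρ) / 2) ≤
    (∫ x in Ka a, (ε ^ 2 + v x ^ 2) ^ ((P x + 2) / 4)) ^ ((2 : ℝ) / (N + 1)) *
    (∫ x in Ka a, ((ε ^ 2 + v x ^ 2) ^ ((P x + ρ / 2) / 2)) ^ ((N : ℝ) / (N - 1))) ^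
      (((N : ℝ) - 1) / (N + 1)) := by
  have hε := D.ε0
  have cP := D.cP
  have cv := D.cv
  have hN1 : (2 : ℝ) ≤ N := by exact_mod_cast hN
  have hn1 : (N : ℝ) - 1 ≠ 0 := by linarith
  have hn2 : (N : ℝ) + 1 ≠ 0 := by linarith
  have hn3 : (N : ℝ) + 2 ≠ 0 := by linarith
  have hWp : ∀ x, 0 < ε ^ 2 + v x ^ 2 := fun x => Wpos hε
  have hc : Real.HolderConjugate (((N : ℝ) + 1) / 2) (((N : ℝ) + 1) / (N - 1)) := by
    rw [Real.holderConjugate_iff]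
    constructor
    · linarith
    · field_simp; ring
  have cg : ContinuousOn (fun x => (ε ^ 2 + v x ^ 2) ^ ((P x + 2) / (2 * (N + 1))))
    (closure (Ka a)) := cont_pow hε cv (by fun_prop)
  have ch : ContinuousOn (fun x => (ε ^ 2 + v x ^ 2) ^ ((P x + ρ / 2) / 2 * (N / (N + 1))))
    (closure (Ka a)) := cont_pow hε cv (by fun_prop)
  have h := holder_Ka a ha hc cg ch (fun x _ => by have := hWp x; positivity)
    (fun x _ => by have := hWp x; positivity)
  refine (le_of_eq ?_).trans (h.trans (le_of_eq ?_))
  · congr 1; ext x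
    rw [← Real.rpow_add (hWp x)]
    congr 1
    subst hρ
    field_simp
    ring
  · congr 1
    · congr 1
      · congr 1; ext x
        rw [← Real.rpow_mul (hWp x).le]
        congr 1
        field_simp; try ring
      · field_simp
    · congr 1
      · congr 1; ext x
        rw [← Real.rpow_mul (hWp x).le, ← Real.rpow_mul (hWp x).le]
        congr 1
        field_simp
      · field_simp

lemma X_le_A {N : ℕ} (hN : 2 ≤ N) {a : Fin N → ℝ} (ha : ∀ i, 0 < a i) (i : Fin N)
    {L Pm M₀ ρ : ℝ} (hL : 0 ≤ L) (hPm : 0 ≤ Pm) (hM : 0 < M₀) (hρ : ρ = 4 / (N + 2)) :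
    ∃ K, 0 < K ∧ ∀ (ε : ℝ) (P u v : (Fin N → ℝ) → ℝ) (dv : Fin N → (Fin N → ℝ) → ℝ),
      Dat a i L Pm M₀ ε P u v dv →
      ∫ x in Ka a, (ε ^ 2 + v x ^ 2) ^ ((P x + ρ) / 2) ≤
        K * ((∫ x in Ka a, Sfun ε P v dv x ^ 2) + 1) := by
  have hN1 : (2 : ℝ) ≤ N := by exact_mod_cast hN
  have hn1 : (N : ℝ) - 1 ≠ 0 := by linarith
  have hn2 : (N : ℝ) + 1 ≠ 0 := by linarith
  have hρ0 : 0 < ρ := by rw [hρ]; positivity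
  have hρ1 : ρ ≤ 1 := by rw [hρ, div_le_one (by linarith)]; linarith
  have hs0 : 0 ≤ ∑ j, 1 / (2 * a j) := Finset.sum_nonneg fun j _ => by have := ha j; positivity
  set C1 := ∑ j, 1 / (2 * a j) + L / 2 + Pm + 1 with hC1
  have hC10 : 0 < C1 := by positivity
  set C4 := 2 * ((L / 4 + (Pm + 2) / 2 + 1) * M₀) +
    volume.real (Ka a) * (2 : ℝ) ^ ((Pm + 2) / 4) with hC4
  have hC40 : 0 < C4 := by positivity
  set s : ℝ := N / (2 * (N + 1)) with hs
  set K := C4 ^ ((2 : ℝ) / (N + 1)) * C1 ^ ((N : ℝ) / (N + 1)) with hK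
  have hK0 : 0 < K := by positivity
  have hs1 : s < 1 := by rw [hs, div_lt_one (by positivity)]; linarith
  refine ⟨K ^ (1 / (1 - s)), by positivity, fun ε P u v dv D => ?_⟩
  have hWp : ∀ x, 0 < ε ^ 2 + v x ^ 2 := fun x => Wpos D.ε0
  have hLW := LW_est hN ha hL hρ0 hρ1 D hPm
  have hZ := Z_est ha hL hM D hPm
  have hH := Hol_est hN ha hρ D
  rw [← hC1] at hLW
  rw [← hC4] at hZ
  have ms := (isOpen_Ka a).measurableSet
  have hA0 : 0 ≤ ∫ x in Ka a, Sfun ε P v dv x ^ 2 := setIntegral_nonneg ms (fun x _ => sq_nonneg _)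
  have hX0 : 0 ≤ ∫ x in Ka a, (ε ^ 2 + v x ^ 2) ^ ((P x + ρ) / 2) :=
    setIntegral_nonneg ms (fun x _ => by have := hWp x; positivity)
  have hZ0 : 0 ≤ ∫ x in Ka a, (ε ^ 2 + v x ^ 2) ^ ((P x + 2) / 4) :=
    setIntegral_nonneg ms (fun x _ => by have := hWp x; positivity)
  have hT0 : 0 ≤ ∫ x in Ka a, ((ε ^ 2 + v x ^ 2) ^ ((P x + ρ / 2) / 2)) ^ ((N : ℝ) / (N - 1)) :=
    setIntegral_nonneg ms (fun x _ => by have := hWp x; positivity)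
  generalize (∫ x in Ka a, Sfun ε P v dv x ^ 2) = A at *
  generalize (∫ x in Ka a, (ε ^ 2 + v x ^ 2) ^ ((P x + ρ) / 2)) = X at *
  generalize (∫ x in Ka a, (ε ^ 2 + v x ^ 2) ^ ((P x + 2) / 4)) = Z at *
  generalize (∫ x in Ka a, ((ε ^ 2 + v x ^ 2) ^ ((P x + ρ / 2) / 2)) ^ ((N : ℝ) / (N - 1))) = T at *
  refine final_algebra hs1 hK0 (by linarith) hX0 ?_
  have hA1 : 0 < A + 1 := by linarith
  have b1 : Z ^ ((2 : ℝ) / (N + 1)) ≤ C4 ^ ((2 : ℝ) / (N + 1)) * (A + 1) ^ ((1 : ℝ) / (N + 1)) := by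
    refine (Real.rpow_le_rpow hZ0 hZ (by positivity)).trans (le_of_eq ?_)
    rw [Real.mul_rpow hC40.le (by positivity), ← Real.rpow_mul hA1.le]
    congr 2; field_simp
  have b2 : T ^ (((N : ℝ) - 1) / (N + 1)) ≤ C1 ^ ((N : ℝ) / (N + 1)) * ((A + 1) ^ s * X ^ s) := by
    have hT : T ≤ (C1 * ((A + 1) ^ (1 / 2 : ℝ) * X ^ (1 / 2 : ℝ))) ^ ((N : ℝ) / (N - 1)) := by
      refine hLW.trans ?_
      refine Real.rpow_le_rpow (by positivity) ?_ (div_nonneg (by linarith) (by linarith))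
      gcongr
      linarith
    refine (Real.rpow_le_rpow hT0 hT (div_nonneg (by linarith) (by linarith))).trans (le_of_eq ?_)
    rw [← Real.rpow_mul (by positivity), Real.mul_rpow hC10.le (by positivity),
      Real.mul_rpow (by positivity) (by positivity), ← Real.rpow_mul hA1.le, ← Real.rpow_mul hX0]
    have q1 : (N : ℝ) / (N - 1) * ((N - 1) / (N + 1)) = N / (N + 1) := by field_simp
    have q2 : 1 / 2 * ((N : ℝ) / (N + 1)) = s := by rw [hs]; field_simp
    rw [q1, q2]
  calc X ≤ _ := hH
    _ ≤ (C4 ^ ((2 : ℝ) / (N + 1)) * (A + 1) ^ ((1 : ℝ) / (N + 1))) *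
        (C1 ^ ((N : ℝ) / (N + 1)) * ((A + 1) ^ s * X ^ s)) := by gcongr
    _ = K * ((A + 1) ^ ((1 : ℝ) / (N + 1)) * (A + 1) ^ s) * X ^ s := by rw [hK]; ring
    _ = K * (A + 1) ^ (1 - s) * X ^ s := by
      rw [← Real.rpow_add hA1]
      congr 3
      rw [hs]; field_simp; ring

lemma pointwise_S {N : ℕ} {W p : ℝ} (hW : 0 < W) (d : Fin N → ℝ) :
    (W ^ ((p - 2) / 4) * ∑ j, |d j| + W ^ (p / 4) * (1 + |Real.log W|)) ^ 2 ≤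
      2 * N * (∑ j, W ^ ((p - 2) / 2) * d j ^ 2) + 4 * (W ^ (p / 2) * (1 + Real.log W ^ 2)) := by
  have e1 : W ^ ((p - 2) / 2) = (W ^ ((p - 2) / 4)) ^ 2 := by
    rw [← Real.rpow_mul_natCast hW.le]; congr 1; push_cast; ring
  have e2 : W ^ (p / 2) = (W ^ (p / 4)) ^ 2 := by
    rw [← Real.rpow_mul_natCast hW.le]; congr 1; push_cast; ring
  rw [e1, e2, ← Finset.mul_sum, ← sq_abs (Real.log W)]
  generalize W ^ ((p - 2) / 4) = Q
  generalize W ^ (p / 4) = B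
  generalize |Real.log W| = l
  have h : (∑ j, |d j|) ^ 2 ≤ N * ∑ j, d j ^ 2 := by
    have := sq_sum_le_card_mul_sum_sq (s := (Finset.univ : Finset (Fin N))) (f := fun j => |d j|)
    simpa using this
  have h2 := mul_le_mul_of_nonneg_left h (sq_nonneg Q)
  nlinarith [sq_nonneg (Q * ∑ j, |d j| - B * (1 + l)), sq_nonneg (B * (1 - l))]

lemma core {N : ℕ} (hN : 2 ≤ N) {a : Fin N → ℝ} (ha : ∀ i, 0 < a i) (i : Fin N)
    {L Pm M₀ ρ : ℝ} (hL : 0 ≤ L) (hPm : 0 ≤ Pm) (hM : 0 < M₀) (hρ : ρ = 4 / (N + 2)) :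
    ∃ C, 0 < C ∧ ∀ (ε : ℝ) (P u v : (Fin N → ℝ) → ℝ) (dv : Fin N → (Fin N → ℝ) → ℝ),
      Dat a i L Pm M₀ ε P u v dv →
      ∫ x in Ka a, (ε ^ 2 + v x ^ 2) ^ ((P x + ρ) / 2) ≤
        C * ((∑ j, ∫ x in Ka a, (ε ^ 2 + v x ^ 2) ^ ((P x - 2) / 2) * dv j x ^ 2) + 1) := by
  obtain ⟨K, hK, h⟩ := X_le_A hN ha i hL hPm hM hρ
  have hρ0 : 0 < ρ := by rw [hρ]; positivity
  obtain ⟨Cl, hCl, hlog⟩ := absorb_log (Pm := Pm) hρ0 (by positivity : 0 < 1 / (8 * K))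
  refine ⟨2 * K * (2 * N + 4 * (volume.real (Ka a) * Cl) + 1), by positivity,
    fun ε P u v dv D => ?_⟩
  have hX := h ε P u v dv D
  have hε := D.ε0
  have cP := D.cP
  have cv := D.cv
  have hWp : ∀ x, 0 < ε ^ 2 + v x ^ 2 := fun x => Wpos D.ε0
  have cS := Sfun_cont hε cP cv D.cdv
  have ms := (isOpen_Ka a).measurableSet
  have cj : ∀ j, ContinuousOn (fun x => (ε ^ 2 + v x ^ 2) ^ ((P x - 2) / 2) * dv j x ^ 2)
    (closure (Ka a)) := fun j => (cont_pow hε cv (by fun_prop)).mul ((D.cdv j).pow 2)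
  have cX : ContinuousOn (fun x => (ε ^ 2 + v x ^ 2) ^ ((P x + ρ) / 2)) (closure (Ka a)) :=
    cont_pow hε cv (by fun_prop)
  have csum : ContinuousOn (fun x => ∑ j, (ε ^ 2 + v x ^ 2) ^ ((P x - 2) / 2) * dv j x ^ 2)
    (closure (Ka a)) := continuousOn_finsetSum _ (fun j _ => cj j)
  have hA : ∫ x in Ka a, Sfun ε P v dv x ^ 2 ≤ ∫ x in Ka a,
      (2 * N * (∑ j, (ε ^ 2 + v x ^ 2) ^ ((P x - 2) / 2) * dv j x ^ 2) +
        4 * (1 / (8 * K) * (ε ^ 2 + v x ^ 2) ^ ((P x + ρ) / 2) + Cl)) := by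
    refine setIntegral_mono_on (integrableOn_Ka a ha (cS.pow 2))
      (integrableOn_Ka a ha ((continuousOn_const.mul csum).add (continuousOn_const.mul
        ((continuousOn_const.mul cX).add continuousOn_const)))) ms ?_
    intro x hx
    have hc := subset_closure hx
    have h1 := pointwise_S (p := P x) (hWp x) (fun j => dv j x)
    have h2 := hlog _ (P x) (hWp x) (D.P1 x hc) (D.Pm x hc)
    unfold Sfun
    linarith
  have hi2 : IntegrableOn (fun x => 1 / (8 * K) * (ε ^ 2 + v x ^ 2) ^ ((P x + ρ) / 2) + Cl)
      (Ka a) := ((integrableOn_Ka a ha cX).const_mul _).add (integrableOn_const_Ka a ha _)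
  rw [integral_add ((integrableOn_Ka a ha csum).const_mul _) (hi2.const_mul _),
    integral_const_mul, integral_const_mul, integral_add ((integrableOn_Ka a ha cX).const_mul _)
      (integrableOn_const_Ka a ha _), integral_const_mul, setIntegral_const_Ka,
    integral_finsetSum _ (fun j _ => integrableOn_Ka a ha (cj j))] at hA
  have hE : 0 ≤ ∑ j, ∫ x in Ka a, (ε ^ 2 + v x ^ 2) ^ ((P x - 2) / 2) * dv j x ^ 2 :=
    Finset.sum_nonneg fun j _ => setIntegral_nonneg ms
      (fun x _ => by have := hWp x; positivity)
  generalize (∑ j, ∫ x in Ka a, (ε ^ 2 + v x ^ 2) ^ ((P x - 2) / 2) * dv j x ^ 2) = E at *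
  generalize (∫ x in Ka a, Sfun ε P v dv x ^ 2) = A at *
  generalize (∫ x in Ka a, (ε ^ 2 + v x ^ 2) ^ ((P x + ρ) / 2)) = X at *
  have hV : 0 ≤ volume.real (Ka a) * Cl := by positivity
  generalize volume.real (Ka a) * Cl = V at *
  have h1 : K * (A + 1) ≤ K * (2 * N * E + 4 * (1 / (8 * K) * X + V) + 1) := by gcongr
  have h2 : K * (2 * N * E + 4 * (1 / (8 * K) * X + V) + 1) =
    K * (2 * N * E + 4 * V + 1) + X / 2 := by field_simp; ring
  have h3 : X ≤ 2 * (K * (2 * N * E + 4 * V + 1)) := by linarith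
  have h4 : 0 ≤ K * (2 * N + 4 * V * E + E) := by positivity
  nlinarith

lemma convex_clKa {N : ℕ} (a : Fin N → ℝ) (ha : ∀ i, 0 < a i) : Convex ℝ (closure (Ka a)) := by
  rw [closure_Ka a ha]
  exact convex_pi fun j _ => convex_Icc _ _

lemma zero_mem_Ka {N : ℕ} (a : Fin N → ℝ) (ha : ∀ i, 0 < a i) : (0 : Fin N → ℝ) ∈ Ka a := by
  intro j; simpa using ha j

lemma clKa_nhds {N : ℕ} {a : Fin N → ℝ} {x : Fin N → ℝ} (hx : x ∈ Ka a) :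
    closure (Ka a) ∈ nhds x :=
  Filter.mem_of_superset ((isOpen_Ka a).mem_nhds hx) subset_closure

lemma uniq_clKa {N : ℕ} (a : Fin N → ℝ) (ha : ∀ i, 0 < a i) :
    UniqueDiffOn ℝ (closure (Ka a)) :=
  uniqueDiffOn_convex (convex_clKa a ha)
    ⟨0, mem_interior_iff_mem_nhds.2 (clKa_nhds (zero_mem_Ka a ha))⟩

/-- directional derivative within the closed box -/
noncomputable def Dw {N : ℕ} (a : Fin N → ℝ) (j : Fin N) (g : (Fin N → ℝ) → ℝ)
    (x : Fin N → ℝ) : ℝ := fderivWithin ℝ g (closure (Ka a)) x (Pi.single j 1)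

lemma Dw_smooth {N : ℕ} (a : Fin N → ℝ) (ha : ∀ i, 0 < a i) (j : Fin N) {g : (Fin N → ℝ) → ℝ}
    (hg : ContDiffOn ℝ (⊤ : ℕ∞) g (closure (Ka a))) :
    ContDiffOn ℝ (⊤ : ℕ∞) (Dw a j g) (closure (Ka a)) := by
  unfold Dw
  exact (hg.fderivWithin (uniq_clKa a ha) (by simp)).clm_apply contDiffOn_const

lemma Dw_eq {N : ℕ} {a : Fin N → ℝ} (j : Fin N) (g : (Fin N → ℝ) → ℝ) {x : Fin N → ℝ}
    (hx : x ∈ Ka a) : Dw a j g x = Dop j g x := by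
  unfold Dw Dop
  rw [fderivWithin_of_mem_nhds (clKa_nhds hx)]

lemma slice_smooth {N : ℕ} {a : Fin N → ℝ} (ha : ∀ i, 0 < a i) {g : (Fin N → ℝ) → ℝ}
    (hg : ContDiffOn ℝ (⊤ : ℕ∞) g (closure (Ka a))) {x : Fin N → ℝ} (hx : x ∈ Ka a) (j : Fin N) :
    AbsolutelyContinuousOnInterval (fun t => g (Function.update x j t)) (-a j) (a j) := by
  refine AC_of_contDiffOn (by have := ha j; linarith) ?_
  refine (hg.of_le (by simp)).comp (g := g) (f := fun t => Function.update x j t)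
    (contDiff_update 1 x j).contDiffOn ?_
  intro t ht
  exact update_mem_clKa ha hx ht

lemma slice_deriv {N : ℕ} {a : Fin N → ℝ} {g : (Fin N → ℝ) → ℝ}
    (hg : ContDiffOn ℝ (⊤ : ℕ∞) g (closure (Ka a))) {x : Fin N → ℝ} (hx : x ∈ Ka a) (j : Fin N)
    {t : ℝ} (ht : t ∈ Set.Ioo (-a j) (a j)) :
    HasDerivAt (fun t => g (Function.update x j t)) (Dw a j g (Function.update x j t)) t := by
  have hy := update_mem_Ka hx ht
  rw [Dw_eq j g hy]
  have hd : DifferentiableAt ℝ g (Function.update x j t) :=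
    (hg.contDiffAt (clKa_nhds hy)).differentiableAt (by simp)
  exact hd.hasFDerivAt.comp_hasDerivAt t (hasDerivAt_update x j t)

lemma Dw_symm {N : ℕ} {a : Fin N → ℝ} (i j : Fin N) {u : (Fin N → ℝ) → ℝ}
    (hu : ContDiffOn ℝ (⊤ : ℕ∞) u (closure (Ka a))) {x : Fin N → ℝ} (hx : x ∈ Ka a) :
    Dw a j (Dw a i u) x = Dop i (Dop j u) x := by
  rw [Dw_eq j _ hx]
  have hux := hu.contDiffAt (clKa_nhds hx)
  have h1 : Dw a i u =ᶠ[nhds x] Dop i u := by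
    filter_upwards [(isOpen_Ka a).mem_nhds hx] with y hy using Dw_eq i u hy
  have hd : DifferentiableAt ℝ (fderiv ℝ u) x :=
    (hux.fderiv_right (m := 1) (by norm_cast)).differentiableAt (by simp)
  have h2 : ∀ k l : Fin N, Dop k (Dop l u) x =
      fderiv ℝ (fderiv ℝ u) x (Pi.single k 1) (Pi.single l 1) := by
    intro k l
    unfold Dop
    rw [fderiv_clm_apply hd (differentiableAt_const _)]
    simp
  have h3 : Dop j (Dw a i u) x = Dop j (Dop i u) x := by
    conv_lhs => unfold Dop
    rw [h1.fderiv_eq]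
    rfl
  rw [h3, h2, h2]
  have := hux.isSymmSndFDerivAt (by simp; norm_cast)
  exact this _ _

lemma Dat_of {N : ℕ} (hN : 2 ≤ N) {a : Fin N → ℝ} (ha : ∀ i, 0 < a i) {L Pm M₀ ε : ℝ}
    {P u : (Fin N → ℝ) → ℝ} (i : Fin N) (hM : 0 < M₀) (hε : ε ∈ Set.Ioo (0 : ℝ) 1)
    (hLip : ∀ x ∈ closure (Ka a), ∀ y ∈ closure (Ka a),
      |P x - P y| ≤ L * Real.sqrt (∑ i, (x i - y i) ^ 2))
    (hP : ∀ x ∈ closure (Ka a), 2 * N / (N + 2) < P x)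
    (hPm : ∀ x ∈ closure (Ka a), P x ≤ Pm) (hPc : ContinuousOn P (closure (Ka a)))
    (hu : ContDiffOn ℝ (⊤ : ℕ∞) u (closure (Ka a))) (hu0 : ∀ x ∈ frontier (Ka a), u x = 0)
    (hnorm : Lnorm 2 (Ka a) u ≤ M₀) :
    Dat a i L Pm M₀ ε P u (Dw a i u) (fun j => Dw a j (Dw a i u)) := by
  have hv := Dw_smooth a ha i hu
  have hfr : ∀ x ∈ Ka a, ∀ t : ℝ, |t| = a i → u (Function.update x i t) = 0 := by
    intro x hx t ht
    apply hu0
    rw [(isOpen_Ka a).frontier_eq]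
    have := abs_le.1 ht.le
    refine ⟨update_mem_clKa ha hx this, fun h => ?_⟩
    have := h i
    simp [ht] at this
  refine ⟨hε.1, hε.2, ?_, hPm, hPc, hu.continuousOn, hv.continuousOn,
    fun j => (Dw_smooth a ha j hv).continuousOn, ?_, fun x hx => slice_smooth ha hu hx i,
    fun x hx j => slice_smooth ha hv hx j, fun x hx t ht => slice_deriv hu hx i ht,
    fun x hx j t ht => slice_deriv hv hx j ht, ?_, ?_, ?_⟩
  · intro x hx
    have h1 := hP x hx
    have h2 : (2 : ℝ) ≤ N := by exact_mod_cast hN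
    have h3 : (1 : ℝ) ≤ 2 * N / (N + 2) := by rw [le_div_iff₀ (by linarith)]; linarith
    linarith
  · intro x hx j s hs t ht
    have h := hLip _ (update_mem_clKa ha hx hs) _ (update_mem_clKa ha hx ht)
    have e : ∑ k, (Function.update x j s k - Function.update x j t k) ^ 2 = (s - t) ^ 2 := by
      rw [Finset.sum_eq_single j]
      · simp
      · intro k _ hk; simp [hk]
      · simp
    rwa [e, Real.sqrt_sq_eq_abs] at h
  · exact fun x hx => hfr x hx _ (by rw [abs_neg, abs_of_pos (ha i)])
  · exact fun x hx => hfr x hx _ (abs_of_pos (ha i))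
  · unfold Lnorm at hnorm
    have e : ∀ x, |u x| ^ (2 : ℝ) = u x ^ 2 := fun x => by
      rw [show (2 : ℝ) = ((2 : ℕ) : ℝ) by norm_num, Real.rpow_natCast, sq_abs]
    simp_rw [e] at hnorm
    rw [← Real.sqrt_eq_rpow] at hnorm
    exact (Real.sqrt_le_left hM.le).1 hnorm

lemma cont_of_lip {N : ℕ} {B : Set (Fin N → ℝ)} {L : ℝ} {P : (Fin N → ℝ) → ℝ}
    (hLip : ∀ x ∈ B, ∀ y ∈ B, |P x - P y| ≤ L * Real.sqrt (∑ i, (x i - y i) ^ 2)) :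
    ContinuousOn P B := by
  intro x hx
  unfold ContinuousWithinAt
  rw [tendsto_iff_dist_tendsto_zero]
  have hc : Continuous (fun y : Fin N → ℝ => L * Real.sqrt (∑ i, (y i - x i) ^ 2)) := by fun_prop
  have ht : Filter.Tendsto (fun y : Fin N → ℝ => L * Real.sqrt (∑ i, (y i - x i) ^ 2))
      (nhdsWithin x B) (nhds 0) := by
    have := (hc.tendsto x).mono_left (nhdsWithin_le_nhds (s := B))
    simpa using this
  refine squeeze_zero' (Filter.Eventually.of_forall fun y => dist_nonneg) ?_ ht
  filter_upwards [self_mem_nhdsWithin] with y hy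
  rw [Real.dist_eq]
  exact hLip y hy x hx

lemma mu_ge_one {N : ℕ} (hN : 2 ≤ N) (hne : (Finset.univ : Finset (Fin N)).Nonempty)
    (a : Fin N → ℝ) (ha : ∀ i, 0 < a i) (p : Fin N → (Fin N → ℝ) → ℝ)
    (hc : ∀ j, ContinuousOn (p j) (closure (Ka a)))
    (hp : ∀ j, ∀ x ∈ closure (Ka a), 2 * N / (N + 2) < p j x) (i : Fin N) :
    1 ≤ sSup ((fun x =>
      (Finset.univ.sup' hne fun j => p j x) / (Finset.univ.inf' hne fun j => p j x)) '' Ka a) := by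
  have h2 : (2 : ℝ) ≤ N := by exact_mod_cast hN
  have h3 : (1 : ℝ) ≤ 2 * N / (N + 2) := by rw [le_div_iff₀ (by linarith)]; linarith
  have hinf : ∀ x ∈ Ka a, 1 ≤ Finset.univ.inf' hne fun j => p j x := by
    intro x hx
    refine Finset.le_inf' _ _ fun j _ => ?_
    have := hp j x (subset_closure hx)
    linarith
  have hle : ∀ x, (Finset.univ.inf' hne fun j => p j x) ≤ Finset.univ.sup' hne fun j => p j x :=
    fun x => (Finset.inf'_le (fun j => p j x) (Finset.mem_univ i)).trans
      (Finset.le_sup' (fun j => p j x) (Finset.mem_univ i))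
  have h0 := zero_mem_Ka a ha
  choose C hC using fun j => (isCompact_closure_Ka a ha).exists_bound_of_continuousOn (hc j)
  refine le_csSup_of_le ?_ (Set.mem_image_of_mem _ h0) ?_
  · refine ⟨∑ j, |C j|, ?_⟩
    rintro _ ⟨x, hx, rfl⟩
    have hi := hinf x hx
    have hs := hle x
    refine (div_le_self (by linarith) hi).trans ?_
    refine Finset.sup'_le _ _ fun j _ => ?_
    have h4 := hC j x (subset_closure hx)
    calc p j x ≤ ‖p j x‖ := le_abs_self _
      _ ≤ |C j| := h4.trans (le_abs_self _)
      _ ≤ _ := Finset.single_le_sum (f := fun j => |C j|) (fun j _ => abs_nonneg _)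
        (Finset.mem_univ j)
  · have hi := hinf 0 h0
    have hs := hle 0
    rw [le_div_iff₀ (by linarith)]
    linarith



theorem stmt15 (N : ℕ) (hN : 2 ≤ N) (hne : (Finset.univ : Finset (Fin N)).Nonempty)
    (a : Fin N → ℝ) (ha : ∀ i, 0 < a i) (L : ℝ) (hL : 0 ≤ L)
    (p : Fin N → (Fin N → ℝ) → ℝ)
    (hLip : ∀ j, ∀ x ∈ closure (Ka a), ∀ y ∈ closure (Ka a),
      |p j x - p j y| ≤ L * Real.sqrt (∑ i, (x i - y i) ^ 2))
    (hp : ∀ j, ∀ x ∈ closure (Ka a), 2 * N / (N + 2) < p j x)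
    (μ : ℝ)
    (hμdef : μ = sSup ((fun x =>
      (Finset.univ.sup' hne fun j => p j x) / (Finset.univ.inf' hne fun j => p j x)) '' Ka a))
    (hμ : μ < 1 + 1 / N)
    (i : Fin N) (r : ℝ) (hr1 : 2 / (N + 2) < r) (hr2 : r < 2 - μ * (2 * N / (N + 2)))
    (δ : ℝ) (hδ : δ ∈ Set.Ioo (0 : ℝ) 1) (M₀ : ℝ) (hM₀ : 0 < M₀) :
    ∃ C : ℝ, ∀ ε ∈ Set.Ioo (0 : ℝ) 1,
      ∀ u : (Fin N → ℝ) → ℝ, ContDiffOn ℝ (⊤ : ℕ∞) u (closure (Ka a)) →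
        (∀ x ∈ frontier (Ka a), u x = 0) → Lnorm 2 (Ka a) u ≤ M₀ →
        (∫ x in Ka a,
            (ε ^ 2 + (Dop i u x) ^ 2) ^ ((p i x + r - 2) / 2) * (Dop i u x) ^ 2) ≤
          δ * (∑ j, ∫ x in Ka a,
              (ε ^ 2 + (Dop i u x) ^ 2) ^ ((p i x - 2) / 2) * (Dop i (Dop j u) x) ^ 2) + C := by
  have hc : ∀ j, ContinuousOn (p j) (closure (Ka a)) := fun j => cont_of_lip (hLip j)
  have hμ1 : 1 ≤ μ := hμdef ▸ mu_ge_one hN hne a ha p hc hp i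
  have hN2 : (2 : ℝ) ≤ N := by exact_mod_cast hN
  have hrρ : r < 4 / ((N : ℝ) + 2) := by
    have h1 : (0 : ℝ) ≤ 2 * N / (N + 2) := by positivity
    have h2 : (4 : ℝ) / (N + 2) = 2 - 2 * N / (N + 2) := by field_simp; ring
    nlinarith
  have hr0 : 0 ≤ r := by
    have : (0 : ℝ) < 2 / (N + 2) := by positivity
    linarith
  obtain ⟨Pm, hPm⟩ := (isCompact_closure_Ka a ha).exists_bound_of_continuousOn (hc i)
  have hPm0 : 0 ≤ Pm := (norm_nonneg _).trans (hPm 0 (subset_closure (zero_mem_Ka a ha)))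
  obtain ⟨C, hC, hcore⟩ := core hN ha i (M₀ := M₀) hL hPm0 hM₀ rfl
  obtain ⟨Ca, hCa, habs⟩ := absorb_power (Pm := Pm) (η := δ / C) (K := 1) hr0 hrρ
    (div_pos hδ.1 hC) one_pos
  refine ⟨δ + volume.real (Ka a) * Ca, fun ε hε u hu hu0 hnorm => ?_⟩
  have D := Dat_of hN ha i hM₀ hε (hLip i) (hp i)
    (fun x hx => (le_abs_self _).trans (hPm x hx)) (hc i) hu hu0 hnorm
  have hX := hcore ε (p i) u _ _ D
  have ms := (isOpen_Ka a).measurableSet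
  have e1 : ∫ x in Ka a, (ε ^ 2 + (Dop i u x) ^ 2) ^ ((p i x + r - 2) / 2) * (Dop i u x) ^ 2 =
      ∫ x in Ka a, (ε ^ 2 + (Dw a i u x) ^ 2) ^ ((p i x + r - 2) / 2) * (Dw a i u x) ^ 2 :=
    setIntegral_congr_fun ms fun x hx => by simp only [Dw_eq i u hx]
  have e2 : ∀ j, ∫ x in Ka a, (ε ^ 2 + (Dop i u x) ^ 2) ^ ((p i x - 2) / 2) *
        (Dop i (Dop j u) x) ^ 2 =
      ∫ x in Ka a, (ε ^ 2 + (Dw a i u x) ^ 2) ^ ((p i x - 2) / 2) *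
        (Dw a j (Dw a i u) x) ^ 2 := fun j =>
    setIntegral_congr_fun ms fun x hx => by simp only [Dw_symm i j hu hx, Dw_eq i u hx]
  simp_rw [e1, e2]
  have cv := D.cv
  have cp := hc i
  have cX : ContinuousOn (fun x => (ε ^ 2 + (Dw a i u x) ^ 2) ^ ((p i x + 4 / ((N : ℝ) + 2)) / 2))
    (closure (Ka a)) := cont_pow hε.1 cv (by fun_prop)
  have cl : ContinuousOn (fun x => (ε ^ 2 + (Dw a i u x) ^ 2) ^ ((p i x + r - 2) / 2))
    (closure (Ka a)) := cont_pow hε.1 cv (by fun_prop)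
  have h1 : ∫ x in Ka a, (ε ^ 2 + (Dw a i u x) ^ 2) ^ ((p i x + r - 2) / 2) * (Dw a i u x) ^ 2 ≤
      ∫ x in Ka a, (δ / C * (ε ^ 2 + (Dw a i u x) ^ 2) ^ ((p i x + 4 / ((N : ℝ) + 2)) / 2) + Ca) := by
    refine setIntegral_mono_on (integrableOn_Ka a ha (cl.mul (cv.pow 2)))
      (((integrableOn_Ka a ha cX).const_mul _).add (integrableOn_const_Ka a ha _)) ms ?_
    intro x hx
    have hx' := subset_closure hx
    have hW := Wpos hε.1 (v := Dw a i u x)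
    have h2 := habs _ (p i x) hW (by linarith [D.P1 x hx']) (D.Pm x hx')
    refine le_trans ?_ h2
    rw [one_mul, show (p i x + r) / 2 = (p i x + r - 2) / 2 + 1 by ring,
      Real.rpow_add_one hW.ne']
    gcongr
    nlinarith [sq_nonneg ε]
  rw [integral_add ((integrableOn_Ka a ha cX).const_mul _) (integrableOn_const_Ka a ha _),
    integral_const_mul, setIntegral_const_Ka] at h1
  refine h1.trans ?_
  have h3 := mul_le_mul_of_nonneg_left hX (div_pos hδ.1 hC).le
  rw [← mul_assoc, div_mul_cancel₀ _ hC.ne'] at h3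
  linarith
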